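/- (Existence and uniqueness for the backward equation.) Assume hypotheses (H1)–(H3), let q0, q be chosen with 1 − 1/p < 1/q0 < min{β, δα, δ/p, 1/2} and 1/(q0·δ) ≤ 1/q < min{α, 1/p}, let ω : [0,T] → ℝ^m be continuous of finite p-variation, and let x_T ∈ ℝ^d. Then the backward Young differential equation x_t = x_T + ∫_t^T f(s,x_s) ds + ∫_t^T g(s,x_s) dω_s, t ∈ [0,T], has a unique solution x in the space of continuous paths of finite q-variation on [0,T]. -/

import Mathlib

open scoped BigOperators
open Set

noncomputable section

/-- Euclidean space `ℝ^n`. -/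
abbrev Ed (n : ℕ) : Type := EuclideanSpace ℝ (Fin n)

section PVarDefs

variable {E F : Type*} [NormedAddCommGroup E] [NormedSpace ℝ E]
  [NormedAddCommGroup F] [NormedSpace ℝ F]

/-- The set of sums `Σ_i ‖x (t (i+1)) - x (t i)‖ ^ p` over all finite partitions
`a = t 0 < t 1 < ⋯ < t n = b` of `[a,b]`. -/
def pVarSums (p : ℝ) (x : ℝ → E) (a b : ℝ) : Set ℝ :=
  { v | ∃ n : ℕ, ∃ t : Fin (n + 1) → ℝ, StrictMono t ∧ t 0 = a ∧ t (Fin.last n) = b ∧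
      v = ∑ i : Fin n, ‖x (t i.succ) - x (t i.castSucc)‖ ^ p }

/-- The `p`-variation seminorm `|||x|||_{p-var,[a,b]}`. -/
def pVar (p : ℝ) (x : ℝ → E) (a b : ℝ) : ℝ :=
  sSup (pVarSums p x a b) ^ (1 / p)

/-- `x` is of finite `p`-variation on `[a,b]`. -/
def FinitePVar (p : ℝ) (x : ℝ → E) (a b : ℝ) : Prop :=
  BddAbove (pVarSums p x a b)

/-- The `p`-variation norm `‖x‖_{p-var,[a,b]} = ‖x a‖ + |||x|||_{p-var,[a,b]}`. -/
def pVarNorm (p : ℝ) (x : ℝ → E) (a b : ℝ) : ℝ :=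
  ‖x a‖ + pVar p x a b

/-- A control function on `[a,b]`: continuous on the simplex, vanishing on the diagonal,
superadditive and nonnegative. -/
def IsControlOn (a b : ℝ) (w : ℝ → ℝ → ℝ) : Prop :=
  ContinuousOn (fun pr : ℝ × ℝ => w pr.1 pr.2) {pr : ℝ × ℝ | a ≤ pr.1 ∧ pr.1 ≤ pr.2 ∧ pr.2 ≤ b} ∧
  (∀ t : ℝ, a ≤ t → t ≤ b → w t t = 0) ∧
  (∀ s t u : ℝ, a ≤ s → s ≤ t → t ≤ u → u ≤ b → w s t + w t u ≤ w s u) ∧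
  (∀ s t : ℝ, a ≤ s → s ≤ t → t ≤ b → 0 ≤ w s t)

/-- A tagged partition `a = t 0 < t 1 < ⋯ < t n = b` of `[a,b]`, with tags
`tag i ∈ [t i, t (i+1)]`. -/
structure TaggedPartition (a b : ℝ) where
  n : ℕ
  t : Fin (n + 1) → ℝ
  tag : Fin n → ℝ
  mono : StrictMono t
  first : t 0 = a
  last : t (Fin.last n) = b
  tag_mem : ∀ i : Fin n, tag i ∈ Set.Icc (t i.castSucc) (t i.succ)

/-- The mesh of a tagged partition. -/
def TaggedPartition.mesh {a b : ℝ} (P : TaggedPartition a b) : ℝ :=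
  ⨆ i : Fin P.n, (P.t i.succ - P.t i.castSucc)

/-- Riemann–Stieltjes sum of `x` against `ω` along a tagged partition. -/
def RSSum (x : ℝ → E →L[ℝ] F) (ω : ℝ → E) {a b : ℝ} (P : TaggedPartition a b) : F :=
  ∑ i : Fin P.n, x (P.tag i) (ω (P.t i.succ) - ω (P.t i.castSucc))

/-- `v` is the Young integral `∫_a^b x dω`: the Riemann–Stieltjes sums converge to `v`
as the mesh tends to `0`. -/
def IsYoungIntegral (x : ℝ → E →L[ℝ] F) (ω : ℝ → E) (a b : ℝ) (v : F) : Prop :=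
  ∀ ε : ℝ, 0 < ε → ∃ δ : ℝ, 0 < δ ∧
    ∀ P : TaggedPartition a b, P.mesh < δ → ‖RSSum x ω P - v‖ < ε

/-- The Young integral `∫_a^b x dω` (an arbitrary value, `0`, if the limit does not exist). -/
def youngIntegral (x : ℝ → E →L[ℝ] F) (ω : ℝ → E) (a b : ℝ) : F :=
  letI := Classical.propDecidable (∃ v, IsYoungIntegral x ω a b v)
  if hv : ∃ v, IsYoungIntegral x ω a b v then hv.choose else 0

end PVarDefs

/-- `x` is a solution on `[0,T1]` of the backward Young differential equation
`x t = xT + ∫_t^{T1} f(s, x s) ds + ∫_t^{T1} g(s, x s) dω_s`, in the space of continuous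
paths of finite `q`-variation. -/
def IsBackwardSolutionOn {d m : ℕ} (f : ℝ → Ed d → Ed d)
    (g : ℝ → Ed d → (Ed m →L[ℝ] Ed d)) (ω : ℝ → Ed m) (q T1 : ℝ) (xT : Ed d)
    (x : ℝ → Ed d) : Prop :=
  ContinuousOn x (Set.Icc 0 T1) ∧ FinitePVar q x 0 T1 ∧ x T1 = xT ∧
    ∀ t ∈ Set.Icc (0:ℝ) T1,
      x t = xT + (∫ s in t..T1, f s (x s)) + youngIntegral (fun s => g s (x s)) ω t T1

/-- A nonnegative superadditive two-parameter function on the simplex over `[0,T]` that is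
uniformly small near the diagonal. -/
structure IsSmallControl (T : ℝ) (W : ℝ → ℝ → ℝ) : Prop where
  nonneg : ∀ s t, 0 ≤ s → s ≤ t → t ≤ T → 0 ≤ W s t
  superadd : ∀ s u t, 0 ≤ s → s ≤ u → u ≤ t → t ≤ T → W s u + W u t ≤ W s t
  small : ∀ ε, 0 < ε → ∃ η, 0 < η ∧ ∀ s t, 0 ≤ s → s ≤ t → t ≤ T → t - s ≤ η → W s t ≤ ε

namespace IsSmallControl

variable {T : ℝ} {W W' : ℝ → ℝ → ℝ}

lemma add (hW : IsSmallControl T W) (hW' : IsSmallControl T W') :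
    IsSmallControl T (fun s t => W s t + W' s t) where
  nonneg s t h1 h2 h3 := add_nonneg (hW.nonneg s t h1 h2 h3) (hW'.nonneg s t h1 h2 h3)
  superadd s u t h1 h2 h3 h4 := by
    have := hW.superadd s u t h1 h2 h3 h4
    have := hW'.superadd s u t h1 h2 h3 h4
    linarith
  small ε hε := by
    obtain ⟨η, hη, H⟩ := hW.small (ε / 2) (by linarith)
    obtain ⟨η', hη', H'⟩ := hW'.small (ε / 2) (by linarith)
    refine ⟨min η η', lt_min hη hη', fun s t h1 h2 h3 h4 => ?_⟩
    have := H s t h1 h2 h3 (h4.trans (min_le_left _ _))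
    have := H' s t h1 h2 h3 (h4.trans (min_le_right _ _))
    linarith

lemma mono (hW : IsSmallControl T W) {s s' t' t : ℝ} (h0 : 0 ≤ s) (h1 : s ≤ s') (h2 : s' ≤ t')
    (h3 : t' ≤ t) (h4 : t ≤ T) : W s' t' ≤ W s t := by
  have a1 := hW.superadd s s' t h0 h1 (h2.trans h3) h4
  have a2 := hW.superadd s' t' t (h0.trans h1) h2 h3 h4
  have a3 := hW.nonneg s s' h0 h1 ((h2.trans h3).trans h4)
  have a4 := hW.nonneg t' t ((h0.trans h1).trans h2) h3 h4
  linarith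

/-- Sums of a control over consecutive intervals of a partition. -/
lemma sum_fin_le (hW : IsSmallControl T W) : ∀ (n : ℕ) (t : Fin (n + 1) → ℝ), Monotone t →
    0 ≤ t 0 → t (Fin.last n) ≤ T →
    ∑ i : Fin n, W (t i.castSucc) (t i.succ) ≤ W (t 0) (t (Fin.last n)) := by
  intro n
  induction n with
  | zero => intro t ht h0 h1; simpa using hW.nonneg _ _ h0 le_rfl h1
  | succ n ih =>
    intro t ht h0 h1
    rw [Fin.sum_univ_castSucc]
    have hm : t (Fin.last n).castSucc ≤ t (Fin.last (n + 1)) := ht (Fin.le_last _)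
    have := ih (fun i => t i.castSucc) (fun i j hij => ht (by simpa using hij)) h0 (hm.trans h1)
    have h2 := hW.superadd (t 0) (t (Fin.last n).castSucc) (t (Fin.last (n + 1))) h0
      (ht (Fin.zero_le _)) hm h1
    simp only [Fin.succ_last, Fin.succ_castSucc, Fin.castSucc_zero] at this ⊢
    linarith

end IsSmallControl

lemma rpow_le_mul_of_le {w ε θ : ℝ} (hw : 0 ≤ w) (hε : w ≤ ε) (hθ : 1 < θ) :
    w ^ θ ≤ ε ^ (θ - 1) * w := by
  rcases hw.eq_or_lt with rfl | hw
  · rw [Real.zero_rpow (by linarith)]; simp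
  · have : w ^ θ = w ^ (θ - 1) * w := by
      rw [← Real.rpow_add_one hw.ne']; congr 1; ring
    rw [this]
    gcongr

/-- The constant in the sewing estimates. -/
def sewingConst (θ : ℝ) : ℝ := 2 / (1 - 2 ^ (1 - θ))

lemma sewingConst_spec {θ : ℝ} (hθ : 1 < θ) :
    0 < sewingConst θ ∧ 2 * (sewingConst θ * (1 / 2) ^ θ) + 2 = sewingConst θ := by
  have h1 : (2 : ℝ) ^ (1 - θ) < 1 := Real.rpow_lt_one_of_one_lt_of_neg (by norm_num) (by linarith)
  have h2 : (2 : ℝ) ^ (1 - θ) = 2 * (1 / 2) ^ θ := by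
    rw [Real.rpow_sub (by norm_num), Real.div_rpow (by norm_num) (by norm_num)]
    simp [div_eq_mul_inv]
  refine ⟨div_pos two_pos (by linarith), ?_⟩
  have h3 : sewingConst θ * (1 - 2 ^ (1 - θ)) = 2 := div_mul_cancel₀ _ (by linarith)
  rw [h2] at h3
  linarith

/-- Discrete sewing estimate for almost additive two-index families. -/
lemma discrete_sewing {E : Type*} [NormedAddCommGroup E] {θ C : ℝ} (hθ : 1 < θ) (hC : 0 ≤ C)
    {a b : ℕ} (R : ℕ → ℕ → E) (w : ℕ → ℕ → ℝ)
    (hw0 : ∀ i j, a ≤ i → i ≤ j → j ≤ b → 0 ≤ w i j)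
    (hws : ∀ i j k, a ≤ i → i ≤ j → j ≤ k → k ≤ b → w i j + w j k ≤ w i k)
    (hR : ∀ i j k, a ≤ i → i ≤ j → j ≤ k → k ≤ b → ‖R i k - R i j - R j k‖ ≤ C * w i k ^ θ) :
    ∀ i j, a ≤ i → i ≤ j → j ≤ b →
      ‖R i j - ∑ k ∈ Finset.Ico i j, R k (k + 1)‖ ≤ sewingConst θ * C * w i j ^ θ := by
  obtain ⟨hA, hA2⟩ := sewingConst_spec hθ
  have hdiag : ∀ i, a ≤ i → i ≤ b → w i i = 0 := fun i h1 h2 => by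
    have := hws i i i h1 le_rfl le_rfl h2
    have := hw0 i i h1 le_rfl h2
    linarith
  have key : ∀ m i j, a ≤ i → i ≤ j → j ≤ b → j - i = m →
      ‖R i j - ∑ k ∈ Finset.Ico i j, R k (k + 1)‖ ≤ sewingConst θ * C * w i j ^ θ := by
    intro m
    induction m using Nat.strong_induction_on with
    | _ m ih =>
      intro i j hai hij hjb hm
      rcases hij.eq_or_lt with rfl | hlt
      · have h1 := hR i i i hai le_rfl le_rfl hjb
        have h2 := hdiag i hai hjb
        rw [h2, Real.zero_rpow (by linarith)] at h1
        simp only [sub_self, zero_sub, norm_neg, mul_zero] at h1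
        simpa [h2, Real.zero_rpow (show θ ≠ 0 by linarith)] using h1
      · obtain ⟨k, hik, hkj, hk1, hk2⟩ : ∃ k, i ≤ k ∧ k < j ∧ w i k ≤ w i j / 2 ∧
            w (k + 1) j ≤ w i j / 2 := by
          classical
          have hne := hw0 i j hai hij hjb
          have hex : ∃ k, i ≤ k ∧ k < j ∧ w (k + 1) j ≤ w i j / 2 := by
            refine ⟨j - 1, by omega, by omega, ?_⟩
            rw [Nat.sub_add_cancel (by omega), hdiag j (by omega) hjb]
            linarith
          obtain ⟨h1, h2, h3⟩ := Nat.find_spec hex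
          refine ⟨Nat.find hex, h1, h2, ?_, h3⟩
          by_cases hki : Nat.find hex = i
          · rw [hki, hdiag i hai (by omega)]
            linarith
          · have h4 := Nat.find_min hex (m := Nat.find hex - 1) (by omega)
            have h5 : ¬ (w (Nat.find hex) j ≤ w i j / 2) := fun h =>
              h4 ⟨by omega, by omega, by rwa [Nat.sub_add_cancel (by omega)]⟩
            have := hws i (Nat.find hex) j hai h1 h2.le hjb
            linarith
        have e1 := hR i (k + 1) j hai (by omega) (by omega) hjb
        have e2 := hR i k (k + 1) hai hik (by omega) (by omega)
        have e3 := ih (k - i) (by omega) i k hai hik (by omega) rfl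
        have e4 := ih (j - (k + 1)) (by omega) (k + 1) j (by omega) (by omega) hjb rfl
        have hmid : w i (k + 1) ≤ w i j := by
          have := hws i (k + 1) j hai (by omega) (by omega) hjb
          have := hw0 (k + 1) j (by omega) (by omega) hjb
          linarith
        have hsum : ∑ l ∈ Finset.Ico i j, R l (l + 1) = ∑ l ∈ Finset.Ico i k, R l (l + 1) +
            (R k (k + 1) + ∑ l ∈ Finset.Ico (k + 1) j, R l (l + 1)) := by
          rw [← Finset.sum_Ico_consecutive _ hik hkj.le, Finset.sum_eq_sum_Ico_succ_bot hkj]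
        have hdec : R i j - ∑ l ∈ Finset.Ico i j, R l (l + 1) =
            (R i j - R i (k + 1) - R (k + 1) j) + (R i (k + 1) - R i k - R k (k + 1)) +
            (R i k - ∑ l ∈ Finset.Ico i k, R l (l + 1)) +
            (R (k + 1) j - ∑ l ∈ Finset.Ico (k + 1) j, R l (l + 1)) := by
          rw [hsum]; abel
        have hhalf : ∀ v, 0 ≤ v → v ≤ w i j / 2 → v ^ θ ≤ (1 / 2) ^ θ * w i j ^ θ := by
          intro v hv0 hv
          rw [← Real.mul_rpow (by norm_num) (hw0 i j hai hij hjb)]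
          exact Real.rpow_le_rpow hv0 (by linarith) (by linarith)
        have e2' : C * w i (k + 1) ^ θ ≤ C * w i j ^ θ :=
          mul_le_mul_of_nonneg_left (Real.rpow_le_rpow (hw0 _ _ hai (by omega) (by omega)) hmid
            (by linarith)) hC
        have e3' := mul_le_mul_of_nonneg_left
          (hhalf _ (hw0 i k hai hik (by omega)) hk1) (mul_nonneg hA.le hC)
        have e4' := mul_le_mul_of_nonneg_left
          (hhalf _ (hw0 (k + 1) j (by omega) (by omega) hjb) hk2) (mul_nonneg hA.le hC)
        rw [hdec]
        calc _ ≤ _ := norm_add₄_le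
          _ ≤ (2 * (sewingConst θ * (1 / 2) ^ θ) + 2) * (C * w i j ^ θ) := by linarith
          _ = _ := by rw [hA2]; ring
  exact fun i j h1 h2 h3 => key _ i j h1 h2 h3 rfl

lemma exists_pos_mul_rpow_le {M ε κ : ℝ} (hM : 0 ≤ M) (hε : 0 < ε) (hκ : 0 < κ) :
    ∃ ε', 0 < ε' ∧ ε' ≤ 1 ∧ M * ε' ^ κ ≤ ε := by
  have hq : 0 < ε / (M + 1) := by positivity
  refine ⟨min 1 ((ε / (M + 1)) ^ (1 / κ)), lt_min one_pos (Real.rpow_pos_of_pos hq _),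
    min_le_left _ _, ?_⟩
  calc M * (min 1 ((ε / (M + 1)) ^ (1 / κ))) ^ κ ≤ M * ((ε / (M + 1)) ^ (1 / κ)) ^ κ := by
        gcongr
        exact min_le_right _ _
    _ = M * (ε / (M + 1)) := by
        rw [← Real.rpow_mul hq.le, one_div_mul_cancel hκ.ne', Real.rpow_one]
    _ ≤ (M + 1) * (ε / (M + 1)) := by gcongr; linarith
    _ = ε := by field_simp

lemma exists_fine_partition {s t η : ℝ} (hst : s ≤ t) (hη : 0 < η) :
    ∃ (n : ℕ) (τ : ℕ → ℝ), Monotone τ ∧ τ 0 = s ∧ τ n = t ∧ ∀ k, τ (k + 1) - τ k ≤ η := by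
  obtain ⟨n, hn⟩ := exists_nat_gt ((t - s) / η)
  have hn0 : (0 : ℝ) < n + 1 := by positivity
  refine ⟨n + 1, fun k => s + k * ((t - s) / ((n : ℝ) + 1)), ?_, by simp, ?_, ?_⟩
  · refine monotone_nat_of_le_succ fun k => ?_
    have : 0 ≤ (t - s) / ((n : ℝ) + 1) := div_nonneg (by linarith) hn0.le
    push_cast
    linarith
  · push_cast
    field_simp
    ring
  · intro k
    have : (t - s) / ((n : ℝ) + 1) ≤ η := by
      rw [div_le_iff₀ hn0]
      rw [div_lt_iff₀ hη] at hn
      linarith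
    push_cast
    linarith

namespace IsSmallControl

variable {T : ℝ} {W : ℝ → ℝ → ℝ}

lemma sum_fin_rpow_le (hW : IsSmallControl T W) {θ ε : ℝ} (hθ : 1 < θ) (hε : 0 ≤ ε)
    (n : ℕ) (t : Fin (n + 1) → ℝ) (ht : Monotone t) (h0 : 0 ≤ t 0) (h1 : t (Fin.last n) ≤ T)
    (hs : ∀ i : Fin n, W (t i.castSucc) (t i.succ) ≤ ε) :
    ∑ i : Fin n, W (t i.castSucc) (t i.succ) ^ θ ≤ ε ^ (θ - 1) * W (t 0) (t (Fin.last n)) := by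
  calc _ ≤ ∑ i : Fin n, ε ^ (θ - 1) * W (t i.castSucc) (t i.succ) := by
        refine Finset.sum_le_sum fun i _ => rpow_le_mul_of_le ?_ (hs i) hθ
        exact hW.nonneg _ _ (h0.trans (ht (Fin.zero_le _))) (ht (Fin.castSucc_lt_succ).le)
          ((ht (Fin.le_last _)).trans h1)
    _ = ε ^ (θ - 1) * ∑ i : Fin n, W (t i.castSucc) (t i.succ) := by rw [Finset.mul_sum]
    _ ≤ _ := mul_le_mul_of_nonneg_left (hW.sum_fin_le n t ht h0 h1) (Real.rpow_nonneg hε _)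

lemma sum_range_rpow_le (hW : IsSmallControl T W) {θ ε : ℝ} (hθ : 1 < θ) (hε : 0 ≤ ε)
    (τ : ℕ → ℝ) (hτ : Monotone τ) (h0 : 0 ≤ τ 0) (n : ℕ) (h1 : τ n ≤ T)
    (hs : ∀ k < n, W (τ k) (τ (k + 1)) ≤ ε) :
    ∑ k ∈ Finset.range n, W (τ k) (τ (k + 1)) ^ θ ≤ ε ^ (θ - 1) * W (τ 0) (τ n) := by
  rw [Finset.sum_range]
  exact hW.sum_fin_rpow_le hθ hε n (fun i => τ i) (fun i j hij => hτ (by exact_mod_cast hij)) h0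
    (by simpa) (fun i => hs i i.2)

/-- An almost additive two-parameter function that is negligible near the diagonal is controlled
by its defect of additivity. -/
lemma sewing_bound (hW : IsSmallControl T W) {E : Type*} [NormedAddCommGroup E] {θ C C' u v : ℝ}
    (hθ : 1 < θ) (hC : 0 ≤ C) (hC' : 0 ≤ C') (hu : 0 ≤ u) (hv : v ≤ T) (R : ℝ → ℝ → E)
    (hR : ∀ s r t, u ≤ s → s ≤ r → r ≤ t → t ≤ v → ‖R s t - R s r - R r t‖ ≤ C * W s t ^ θ)
    (hR' : ∀ s t, u ≤ s → s ≤ t → t ≤ v → ‖R s t‖ ≤ C' * W s t ^ θ)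
    {s t : ℝ} (hs : u ≤ s) (hst : s ≤ t) (ht : t ≤ v) :
    ‖R s t‖ ≤ sewingConst θ * C * W s t ^ θ := by
  refine le_of_forall_pos_le_add fun ε hε => ?_
  have hWst := hW.nonneg s t (hu.trans hs) hst (ht.trans hv)
  obtain ⟨ε', hε', -, hsmall⟩ := exists_pos_mul_rpow_le (mul_nonneg hC' hWst) hε
    (sub_pos.2 hθ)
  obtain ⟨η, hη, Hη⟩ := hW.small ε' hε'
  obtain ⟨n, τ, hτ, hτ0, hτn, hmesh⟩ := exists_fine_partition hst hη
  have hlo : ∀ k, s ≤ τ k := fun k => hτ0 ▸ hτ (Nat.zero_le k)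
  have hhi : ∀ k ≤ n, τ k ≤ t := fun k hk => hτn ▸ hτ hk
  have h1 := discrete_sewing hθ hC (a := 0) (b := n) (fun i j => R (τ i) (τ j))
    (fun i j => W (τ i) (τ j))
    (fun i j _ hij hj => hW.nonneg _ _ ((hu.trans hs).trans (hlo i)) (hτ hij)
      (((hhi j hj).trans ht).trans hv))
    (fun i j k _ hij hjk hk => hW.superadd _ _ _ ((hu.trans hs).trans (hlo i)) (hτ hij) (hτ hjk)
      (((hhi k hk).trans ht).trans hv))
    (fun i j k _ hij hjk hk => hR _ _ _ (hs.trans (hlo i)) (hτ hij) (hτ hjk) ((hhi k hk).trans ht))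
    0 n le_rfl (Nat.zero_le _) le_rfl
  simp only [hτ0, hτn, Nat.Ico_zero_eq_range] at h1
  have h2 : ‖∑ k ∈ Finset.range n, R (τ k) (τ (k + 1))‖ ≤ ε := by
    calc _ ≤ ∑ k ∈ Finset.range n, C' * W (τ k) (τ (k + 1)) ^ θ := by
          refine norm_sum_le_of_le _ fun k hk => hR' _ _ (hs.trans (hlo k)) (hτ (Nat.le_succ k)) ?_
          exact (hhi _ (Finset.mem_range.1 hk)).trans ht
      _ = C' * ∑ k ∈ Finset.range n, W (τ k) (τ (k + 1)) ^ θ := by rw [Finset.mul_sum]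
      _ ≤ C' * (ε' ^ (θ - 1) * W (τ 0) (τ n)) := by
          refine mul_le_mul_of_nonneg_left (hW.sum_range_rpow_le hθ hε'.le τ hτ
            (hτ0 ▸ hu.trans hs) n (hτn ▸ ht.trans hv) fun k hk => ?_) hC'
          exact Hη _ _ ((hu.trans hs).trans (hlo k)) (hτ (Nat.le_succ k))
            (((hhi _ hk).trans ht).trans hv) (hmesh k)
      _ = C' * W s t * ε' ^ (θ - 1) := by rw [hτ0, hτn]; ring
      _ ≤ ε := hsmall
  calc ‖R s t‖ = ‖(R s t - ∑ k ∈ Finset.range n, R (τ k) (τ (k + 1))) +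
        ∑ k ∈ Finset.range n, R (τ k) (τ (k + 1))‖ := by rw [sub_add_cancel]
    _ ≤ _ := (norm_add_le _ _).trans (add_le_add h1 h2)

end IsSmallControl

lemma exists_tendsto_of_eventually_norm_le {ι F : Type*} [NormedAddCommGroup F] [ProperSpace F]
    (U : Ultrafilter ι) {z : ι → F} {B : ℝ} (hz : ∀ᶠ n in (U : Filter ι), ‖z n‖ ≤ B) :
    ∃ x, Filter.Tendsto z U (nhds x) := by
  obtain ⟨x, -, hx⟩ := (isCompact_closedBall (0 : F) B).ultrafilter_le_nhds (U.map z) (by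
    rw [Filter.le_principal_iff]
    change ∀ᶠ n in (U : Filter ι), z n ∈ Metric.closedBall (0 : F) B
    filter_upwards [hz] with n hn
    simpa using hn)
  exact ⟨x, hx⟩

/-- Sewing lemma: an almost additive two-parameter function is approximated by the increments of
a path. -/
lemma IsSmallControl.exists_sewing {T : ℝ} {W : ℝ → ℝ → ℝ} (hW : IsSmallControl T W) (hT : 0 ≤ T)
    {F : Type*} [NormedAddCommGroup F] [ProperSpace F] {θ C : ℝ} (hθ : 1 < θ) (hC : 0 ≤ C)
    (Ξ : ℝ → ℝ → F)
    (hΞ : ∀ s r t, 0 ≤ s → s ≤ r → r ≤ t → t ≤ T → ‖Ξ s t - Ξ s r - Ξ r t‖ ≤ C * W s t ^ θ) :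
    ∃ I : ℝ → F, ∀ s t, 0 ≤ s → s ≤ t → t ≤ T →
      ‖I t - I s - Ξ s t‖ ≤ sewingConst θ * C * W s t ^ θ := by
  have hdiag : ∀ s, 0 ≤ s → s ≤ T → Ξ s s = 0 := by
    intro s h0 h1
    have h2 := hΞ s s s h0 le_rfl le_rfl h1
    have h3 : W s s = 0 := by
      have := hW.superadd s s s h0 le_rfl le_rfl h1
      have := hW.nonneg s s h0 le_rfl h1
      linarith
    rw [h3, Real.zero_rpow (by linarith)] at h2
    simpa using h2
  have hnn := hW.nonneg
  set τ : ℕ → ℕ → ℝ := fun n k => k * (T / (n + 1)) with hτdef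
  have hτmono : ∀ n, Monotone (τ n) := fun n => monotone_nat_of_le_succ fun k => by
    have : 0 ≤ T / ((n : ℝ) + 1) := by positivity
    simp only [hτdef]; push_cast; linarith
  have hτ0 : ∀ n, τ n 0 = 0 := fun n => by simp [hτdef]
  have hτn : ∀ n, τ n (n + 1) = T := fun n => by
    simp only [hτdef]; push_cast; field_simp
  have hτnn : ∀ n k, 0 ≤ τ n k := fun n k => by simp only [hτdef]; positivity
  set S : ℕ → ℝ → F := fun n t =>
    ∑ k ∈ Finset.range (n + 1), Ξ (min (τ n k) t) (min (τ n (k + 1)) t) with hS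
  have main : ∀ ε, 0 < ε → ∀ᶠ n in Filter.atTop, ∀ s t, 0 ≤ s → s ≤ t → t ≤ T →
      ‖S n t - S n s - Ξ s t‖ ≤ sewingConst θ * C * W s t ^ θ + ε := by
    intro ε hε
    have hWT := hnn 0 T le_rfl hT le_rfl
    obtain ⟨ε', hε', -, hsmall⟩ := exists_pos_mul_rpow_le (mul_nonneg hC hWT) hε (sub_pos.2 hθ)
    obtain ⟨η, hη, Hη⟩ := hW.small ε' hε'
    have hlim : ∀ᶠ n : ℕ in Filter.atTop, T / ((n : ℝ) + 1) ≤ η := by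
      have : Filter.Tendsto (fun n : ℕ => T / ((n : ℝ) + 1)) Filter.atTop (nhds 0) := by
        simpa [Function.comp_def] using
          (tendsto_const_div_atTop_nhds_zero_nat T).comp (Filter.tendsto_add_atTop_nat 1)
      exact (this.eventually (gt_mem_nhds hη)).mono fun n hn => hn.le
    filter_upwards [hlim] with n hn s t hs hst ht
    have ht0 : 0 ≤ t := hs.trans hst
    set σ : ℕ → ℝ := fun k => max s (min (τ n k) t) with hσ
    set ρ : ℕ → ℝ := fun k => min (τ n k) t with hρ
    have hρm : Monotone ρ := fun i j hij => min_le_min_right _ (hτmono n hij)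
    have hσm : Monotone σ := fun i j hij => max_le_max_left _ (hρm hij)
    have hσ0 : σ 0 = s := by simp [hσ, hτ0, ht0, hs]
    have hσn : σ (n + 1) = t := by simp [hσ, hτn, ht, hst]
    have hσs : ∀ k, s ≤ σ k := fun k => le_max_left _ _
    have hσt : ∀ k, σ k ≤ t := fun k => max_le hst (min_le_right _ _)
    have h1 := discrete_sewing hθ hC (a := 0) (b := n + 1) (fun i j => Ξ (σ i) (σ j))
      (fun i j => W (σ i) (σ j))
      (fun i j _ hij hj => hnn _ _ (hs.trans (hσs i)) (hσm hij) ((hσt j).trans ht))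
      (fun i j k _ hij hjk hk => hW.superadd _ _ _ (hs.trans (hσs i)) (hσm hij) (hσm hjk)
        ((hσt k).trans ht))
      (fun i j k _ hij hjk hk => hΞ _ _ _ (hs.trans (hσs i)) (hσm hij) (hσm hjk)
        ((hσt k).trans ht))
      0 (n + 1) le_rfl (Nat.zero_le _) le_rfl
    simp only [hσ0, hσn, Nat.Ico_zero_eq_range] at h1
    have hρ0 : ρ 0 = 0 := by simp [hρ, hτ0, ht0]
    have hρn : ρ (n + 1) = t := by simp [hρ, hτn, ht]
    have hρnn : ∀ k, 0 ≤ ρ k := fun k => le_min (hτnn n k) ht0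
    have hρt : ∀ k, ρ k ≤ t := fun k => min_le_right _ _
    have hstep : ∀ k, τ n (k + 1) = τ n k + T / (n + 1) := fun k => by
      simp only [hτdef]; push_cast; ring
    have hcell : ∀ k, ‖Ξ (ρ k) (ρ (k + 1)) - Ξ (min (τ n k) s) (min (τ n (k + 1)) s) -
        Ξ (σ k) (σ (k + 1))‖ ≤ C * W (ρ k) (ρ (k + 1)) ^ θ := by
      intro k
      have hle := hτmono n (Nat.le_succ k)
      have hrhs : 0 ≤ C * W (ρ k) (ρ (k + 1)) ^ θ := mul_nonneg hC
        (Real.rpow_nonneg (hnn _ _ (hρnn k) (hρm (Nat.le_succ k)) ((hρt _).trans ht)) _)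
      rcases le_total (τ n (k + 1)) s with hb | hb
      · have ha := hle.trans hb
        have : Ξ (ρ k) (ρ (k + 1)) - Ξ (min (τ n k) s) (min (τ n (k + 1)) s) -
            Ξ (σ k) (σ (k + 1)) = 0 := by
          simp only [hρ, hσ, min_eq_left ha, min_eq_left hb, min_eq_left (ha.trans hst),
            min_eq_left (hb.trans hst), max_eq_left ha, max_eq_left hb,
            hdiag s hs (hst.trans ht)]
          simp
        rwa [this, norm_zero]
      · rcases le_total s (τ n k) with ha | ha
        · have : Ξ (ρ k) (ρ (k + 1)) - Ξ (min (τ n k) s) (min (τ n (k + 1)) s) -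
              Ξ (σ k) (σ (k + 1)) = 0 := by
            simp only [hρ, hσ, min_eq_right ha, min_eq_right hb, max_eq_right (le_min ha hst),
              max_eq_right (le_min hb hst), hdiag s hs (hst.trans ht)]
            simp
          rwa [this, norm_zero]
        · have e1 : σ k = s := by
            simp only [hσ]; exact max_eq_left ((min_le_left _ _).trans ha)
          have e2 : σ (k + 1) = ρ (k + 1) := max_eq_right (le_min hb hst)
          have e3 : ρ k = τ n k := min_eq_left (ha.trans hst)
          rw [min_eq_left ha, min_eq_right hb, e1, e2, ← e3]
          exact hΞ _ _ _ (hρnn k) (e3.trans_le ha) (le_min hb hst) ((hρt _).trans ht)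
    have h2 : ‖S n t - S n s - ∑ k ∈ Finset.range (n + 1), Ξ (σ k) (σ (k + 1))‖ ≤ ε := by
      simp only [hS, ← Finset.sum_sub_distrib]
      calc _ ≤ ∑ k ∈ Finset.range (n + 1), C * W (ρ k) (ρ (k + 1)) ^ θ :=
            norm_sum_le_of_le _ fun k _ => hcell k
        _ = C * ∑ k ∈ Finset.range (n + 1), W (ρ k) (ρ (k + 1)) ^ θ := by rw [Finset.mul_sum]
        _ ≤ C * (ε' ^ (θ - 1) * W (ρ 0) (ρ (n + 1))) := by
            refine mul_le_mul_of_nonneg_left (hW.sum_range_rpow_le hθ hε'.le ρ hρm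
              (hρnn 0) _ ((hρt _).trans ht) fun k _ => ?_) hC
            refine Hη _ _ (hρnn k) (hρm (Nat.le_succ k)) ((hρt _).trans ht) ?_
            simp only [hρ, hstep]
            rcases le_total (τ n k) t with h | h
            · rw [min_eq_left h]
              have := min_le_left (τ n k + T / (↑n + 1)) t
              linarith
            · rw [min_eq_right h]
              have := min_le_right (τ n k + T / (↑n + 1)) t
              linarith
        _ ≤ C * (ε' ^ (θ - 1) * W 0 T) := by
            gcongr
            rw [hρ0, hρn]
            exact hW.mono le_rfl le_rfl ht0 ht le_rfl
        _ = C * W 0 T * ε' ^ (θ - 1) := by ring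
        _ ≤ ε := hsmall
    calc ‖S n t - S n s - Ξ s t‖ =
          ‖(S n t - S n s - ∑ k ∈ Finset.range (n + 1), Ξ (σ k) (σ (k + 1))) -
          (Ξ s t - ∑ k ∈ Finset.range (n + 1), Ξ (σ k) (σ (k + 1)))‖ := by congr 1; abel
      _ ≤ ε + sewingConst θ * C * W s t ^ θ := (norm_sub_le _ _).trans (add_le_add h2 h1)
      _ = _ := add_comm _ _
  let U : Ultrafilter ℕ := Filter.hyperfilter ℕ
  have hU : (U : Filter ℕ) ≤ Filter.atTop := Nat.hyperfilter_le_atTop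
  have hS0 : ∀ n, S n 0 = 0 := by
    intro n
    simp only [hS]
    refine Finset.sum_eq_zero fun k _ => ?_
    rw [min_eq_right (hτnn _ _), min_eq_right (hτnn _ _), hdiag 0 le_rfl hT]
  have hlim : ∀ t, ∃ x, 0 ≤ t → t ≤ T → Filter.Tendsto (fun n => S n t) U (nhds x) := by
    intro t
    by_cases h : 0 ≤ t ∧ t ≤ T
    · obtain ⟨x, hx⟩ := exists_tendsto_of_eventually_norm_le U (z := fun n => S n t)
        (B := sewingConst θ * C * W 0 t ^ θ + 1 + ‖Ξ 0 t‖) (by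
          filter_upwards [hU (main 1 one_pos)] with n hn
          have h1 := hn 0 t le_rfl h.1 h.2
          rw [hS0, sub_zero] at h1
          calc ‖S n t‖ = ‖(S n t - Ξ 0 t) + Ξ 0 t‖ := by rw [sub_add_cancel]
            _ ≤ _ := (norm_add_le _ _).trans (by linarith))
      exact ⟨x, fun _ _ => hx⟩
    · exact ⟨0, fun h0 h1 => absurd ⟨h0, h1⟩ h⟩
  choose I hI using hlim
  refine ⟨I, fun s t hs hst ht => le_of_forall_pos_le_add fun ε hε => ?_⟩
  have h1 := hI s hs (hst.trans ht)
  have h2 := hI t (hs.trans hst) ht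
  refine le_of_tendsto ((h2.sub h1).sub_const (Ξ s t)).norm ?_
  filter_upwards [hU (main ε hε)] with n hn using hn s t hs hst ht

section PVarControl

variable {E : Type*} [NormedAddCommGroup E] {p p' : ℝ} {x : ℝ → E}

lemma zero_mem_pVarSums (a : ℝ) : (0 : ℝ) ∈ pVarSums p x a a :=
  ⟨0, fun _ => a, fun i j hij => absurd hij (by omega), rfl, rfl, by simp⟩

lemma pVarSums_snoc (hp : 0 < p) {v a b c : ℝ} (hv : v ∈ pVarSums p x a b) (hbc : b ≤ c) :
    v + ‖x c - x b‖ ^ p ∈ pVarSums p x a c := by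
  rcases hbc.eq_or_lt with rfl | hbc
  · simpa [Real.zero_rpow hp.ne'] using hv
  obtain ⟨n, t, ht, h0, hl, rfl⟩ := hv
  refine ⟨n + 1, Fin.snoc (α := fun _ => ℝ) t c, ?_, ?_, by simp, ?_⟩
  · rw [Fin.strictMono_iff_lt_succ]
    intro i
    refine Fin.lastCases ?_ (fun i => ?_) i
    · rw [Fin.succ_last, Fin.snoc_castSucc, Fin.snoc_last, hl]
      exact hbc
    · rw [Fin.succ_castSucc, Fin.snoc_castSucc, Fin.snoc_castSucc]
      exact ht Fin.castSucc_lt_succ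
  · rw [← Fin.castSucc_zero, Fin.snoc_castSucc, h0]
  · rw [Fin.sum_univ_castSucc]
    simp only [Fin.succ_last, Fin.succ_castSucc, Fin.snoc_castSucc, Fin.snoc_last, hl]

lemma pVarSums_add (hp : 0 < p) {v v' a b c : ℝ} (hv : v ∈ pVarSums p x a b)
    (hv' : v' ∈ pVarSums p x b c) : v + v' ∈ pVarSums p x a c := by
  obtain ⟨n, t, ht, h0, hl, rfl⟩ := hv'
  induction n generalizing c with
  | zero =>
    have : b = c := by rw [← h0, ← hl]; rfl
    subst this
    simpa using hv
  | succ n ih =>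
    rw [Fin.sum_univ_castSucc, ← add_assoc]
    have h1 := ih (c := t (Fin.last n).castSucc) (fun i => t i.castSucc)
      (fun i j hij => ht (by simpa using hij)) h0 rfl
    have h2 := pVarSums_snoc hp h1 (ht.monotone (Fin.le_last (Fin.last n).castSucc))
    rw [hl] at h2
    simpa [hl] using h2

lemma nonneg_of_mem_pVarSums {v a b : ℝ} (hv : v ∈ pVarSums p x a b) : 0 ≤ v := by
  obtain ⟨n, t, -, -, -, rfl⟩ := hv
  positivity

lemma rpow_mem_pVarSums (hp : 0 < p) {a b : ℝ} (hab : a ≤ b) :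
    ‖x b - x a‖ ^ p ∈ pVarSums p x a b := by
  simpa using pVarSums_snoc hp (zero_mem_pVarSums a) hab

lemma le_of_mem_pVarSums (hp : 0 < p) {T B s t v : ℝ} (hB : ∀ v ∈ pVarSums p x 0 T, v ≤ B)
    (hs : 0 ≤ s) (ht : t ≤ T) (hv : v ∈ pVarSums p x s t) : v ≤ B := by
  have h1 := hB _ (pVarSums_snoc hp (pVarSums_add hp (rpow_mem_pVarSums hp hs) hv) ht)
  have h2 : 0 ≤ ‖x s - x 0‖ ^ p := by positivity
  have h3 : 0 ≤ ‖x T - x t‖ ^ p := by positivity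
  linarith

lemma pVarSums_interpolate (hp : 0 < p) (hpp' : p < p') {s t ε v : ℝ}
    (hε : ∀ r r', s ≤ r → r ≤ r' → r' ≤ t → r' - r ≤ t - s → ‖x r' - x r‖ ≤ ε)
    (hv : v ∈ pVarSums p' x s t) : ∃ v' ∈ pVarSums p x s t, v ≤ ε ^ (p' - p) * v' := by
  obtain ⟨n, τ, hτ, h0, hl, rfl⟩ := hv
  refine ⟨_, ⟨n, τ, hτ, h0, hl, rfl⟩, ?_⟩
  rw [Finset.mul_sum]
  refine Finset.sum_le_sum fun i _ => ?_
  have h1 : s ≤ τ i.castSucc := h0 ▸ hτ.monotone (Fin.zero_le _)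
  have h2 : τ i.succ ≤ t := hl ▸ hτ.monotone (Fin.le_last _)
  have h3 := hε _ _ h1 (hτ Fin.castSucc_lt_succ).le h2 (by linarith)
  rcases (norm_nonneg (x (τ i.succ) - x (τ i.castSucc))).eq_or_lt with h | h
  · rw [← h, Real.zero_rpow (by linarith), Real.zero_rpow hp.ne', mul_zero]
  · rw [show p' = (p' - p) + p by ring, Real.rpow_add h, add_sub_cancel_right]
    gcongr

/-- A continuous path of finite `p`-variation has, for `p' > p`, a `p'`-variation that is
uniformly small near the diagonal. -/
lemma isSmallControl_sSup_pVarSums (hp : 0 < p) (hpp' : p < p') {T : ℝ}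
    (hx : ContinuousOn x (Set.Icc 0 T)) (hxp : FinitePVar p x 0 T) :
    IsSmallControl T (fun s t => sSup (pVarSums p' x s t)) ∧
      ∀ s t, 0 ≤ s → s ≤ t → t ≤ T →
        ‖x t - x s‖ ≤ sSup (pVarSums p' x s t) ^ (1 / p') := by
  have hp' : 0 < p' := hp.trans hpp'
  obtain ⟨B, hB⟩ := hxp
  have hB' : ∀ v ∈ pVarSums p x 0 T, v ≤ B := fun v hv => hB hv
  obtain ⟨M, hM⟩ := isCompact_Icc.exists_bound_of_continuousOn hx
  have hbdd : ∀ s t, 0 ≤ s → t ≤ T → BddAbove (pVarSums p' x s t) := by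
    intro s t hs ht
    refine ⟨(M + M) ^ (p' - p) * B, fun v hv => ?_⟩
    obtain ⟨v', hv', hle⟩ := pVarSums_interpolate (ε := M + M) hp hpp'
      (fun r r' h1 h2 h3 _ => (norm_sub_le _ _).trans (add_le_add
        (hM _ ⟨hs.trans (h1.trans h2), h3.trans ht⟩) (hM _ ⟨hs.trans h1, (h2.trans h3).trans ht⟩)))
      hv
    rcases pVarSums.eq_1 p' x s t ▸ hv with ⟨n, τ, hτ, h0, hl, -⟩
    have hst : s ≤ t := h0 ▸ hl ▸ hτ.monotone (Fin.zero_le _)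
    have hM0 : 0 ≤ M := (norm_nonneg _).trans (hM s ⟨hs, hst.trans ht⟩)
    exact hle.trans (mul_le_mul_of_nonneg_left (le_of_mem_pVarSums hp hB' hs ht hv')
      (by positivity))
  refine ⟨⟨fun s t _ _ _ => Real.sSup_nonneg fun v hv => nonneg_of_mem_pVarSums hv, ?_, ?_⟩, ?_⟩
  · intro s u t hs hsu hut ht
    have hne1 : (pVarSums p' x s u).Nonempty := ⟨_, rpow_mem_pVarSums hp' hsu⟩
    have hne2 : (pVarSums p' x u t).Nonempty := ⟨_, rpow_mem_pVarSums hp' hut⟩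
    rw [← le_sub_iff_add_le]
    refine csSup_le hne1 fun v hv => ?_
    rw [le_sub_comm]
    refine csSup_le hne2 fun v' hv' => ?_
    rw [le_sub_iff_add_le, add_comm]
    exact le_csSup (hbdd s t hs ht) (pVarSums_add hp' hv hv')
  · intro ε hε
    have hB0 : 0 ≤ max B 0 := le_max_right _ _
    obtain ⟨ε', hε', -, hsm⟩ := exists_pos_mul_rpow_le hB0 hε (sub_pos.2 hpp')
    have huc := isCompact_Icc.uniformContinuousOn_of_continuous hx
    obtain ⟨η, hη, Hη⟩ := Metric.uniformContinuousOn_iff_le.1 huc ε' hε'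
    refine ⟨η, hη, fun s t hs hst ht htη => csSup_le ⟨_, rpow_mem_pVarSums hp' hst⟩
      fun v hv => ?_⟩
    obtain ⟨v', hv', hle⟩ := pVarSums_interpolate (ε := ε') hp hpp'
      (fun r r' h1 h2 h3 h4 => by
        rw [← dist_eq_norm]
        refine Hη _ ⟨hs.trans (h1.trans h2), h3.trans ht⟩ _ ⟨hs.trans h1, (h2.trans h3).trans ht⟩ ?_
        rw [Real.dist_eq, abs_of_nonneg (by linarith)]
        linarith) hv
    calc v ≤ ε' ^ (p' - p) * v' := hle
      _ ≤ ε' ^ (p' - p) * max B 0 := by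
        gcongr
        exact (le_of_mem_pVarSums hp hB' hs ht hv').trans (le_max_left _ _)
      _ ≤ ε := by linarith
  · intro s t hs hst ht
    rw [one_div, Real.le_rpow_inv_iff_of_pos (norm_nonneg _)
      (Real.sSup_nonneg fun v hv => nonneg_of_mem_pVarSums hv) hp']
    exact le_csSup (hbdd s t hs ht) (rpow_mem_pVarSums hp' hst)

lemma IsSmallControl.finitePVar {T : ℝ} {W : ℝ → ℝ → ℝ} (hW : IsSmallControl T W) {q K : ℝ}
    (hq : 0 < q) (hK : 0 ≤ K)
    (hx : ∀ s t, 0 ≤ s → s ≤ t → t ≤ T → ‖x t - x s‖ ≤ K * W s t ^ (1 / q)) :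
    FinitePVar q x 0 T := by
  refine ⟨K ^ q * W 0 T, ?_⟩
  rintro v ⟨n, t, ht, h0, hl, rfl⟩
  have h1 := hW.sum_fin_le n t ht.monotone h0.ge hl.le
  rw [h0, hl] at h1
  refine le_trans ?_ (mul_le_mul_of_nonneg_left h1 (by positivity))
  rw [Finset.mul_sum]
  refine Finset.sum_le_sum fun i _ => ?_
  have a1 : 0 ≤ t i.castSucc := h0 ▸ ht.monotone (Fin.zero_le _)
  have a2 : t i.succ ≤ T := hl ▸ ht.monotone (Fin.le_last _)
  have a3 : t i.castSucc ≤ t i.succ := (ht Fin.castSucc_lt_succ).le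
  have hWnn := hW.nonneg _ _ a1 a3 a2
  calc _ ≤ (K * W (t i.castSucc) (t i.succ) ^ (1 / q)) ^ q :=
        Real.rpow_le_rpow (norm_nonneg _) (hx _ _ a1 a3 a2) hq.le
    _ = _ := by
      rw [Real.mul_rpow hK (Real.rpow_nonneg hWnn _), ← Real.rpow_mul hWnn,
        one_div_mul_cancel hq.ne', Real.rpow_one]

end PVarControl

section YoungIntegralLemmas

variable {E F : Type*} [NormedAddCommGroup E] [NormedSpace ℝ E]
  [NormedAddCommGroup F] [NormedSpace ℝ F]

lemma TaggedPartition.sub_le_mesh {a b : ℝ} (P : TaggedPartition a b) (i : Fin P.n) :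
    P.t i.succ - P.t i.castSucc ≤ P.mesh :=
  le_ciSup (f := fun i : Fin P.n => P.t i.succ - P.t i.castSucc) (Set.finite_range _).bddAbove i

lemma exists_taggedPartition_mesh_lt {a b δ : ℝ} (hab : a ≤ b) (hδ : 0 < δ) :
    ∃ P : TaggedPartition a b, P.mesh < δ := by
  rcases hab.eq_or_lt with rfl | hab
  · refine ⟨⟨0, fun _ => a, fun i => i.elim0, fun i j hij => absurd hij (by omega), rfl, rfl,
      fun i => i.elim0⟩, ?_⟩
    simpa [TaggedPartition.mesh] using hδ
  · obtain ⟨n, hn⟩ := exists_nat_gt ((b - a) / δ)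
    have hn0 : (0 : ℝ) < n + 1 := by positivity
    have hc : 0 < (b - a) / (n + 1 : ℝ) := div_pos (by linarith) hn0
    refine ⟨⟨n + 1, fun i => a + (i : ℕ) * ((b - a) / (n + 1)),
      fun i => a + (i : ℕ) * ((b - a) / (n + 1)), ?_, by simp, ?_, ?_⟩, ?_⟩
    · intro i j hij
      have : ((i : ℕ) : ℝ) < (j : ℕ) := by exact_mod_cast hij
      simp only
      gcongr
    · simp only [Fin.val_last]
      push_cast
      field_simp
      ring
    · intro i
      simp only [Fin.val_castSucc, Fin.val_succ]
      push_cast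
      exact ⟨le_rfl, by linarith⟩
    · refine lt_of_le_of_lt (ciSup_le (c := (b - a) / (n + 1)) fun i => ?_) ?_
      · simp only [Fin.val_castSucc, Fin.val_succ]
        push_cast
        linarith
      · rw [div_lt_iff₀ hn0]
        rw [div_lt_iff₀ hδ] at hn
        linarith

lemma IsYoungIntegral.youngIntegral_eq {x : ℝ → E →L[ℝ] F} {ω : ℝ → E} {a b : ℝ} {v : F}
    (hab : a ≤ b) (hv : IsYoungIntegral x ω a b v) : youngIntegral x ω a b = v := by
  have hex : ∃ v, IsYoungIntegral x ω a b v := ⟨v, hv⟩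
  rw [youngIntegral, dif_pos hex]
  have hw := hex.choose_spec
  refine eq_of_forall_dist_le fun ε hε => ?_
  obtain ⟨δ₁, h1, H1⟩ := hv (ε / 2) (by linarith)
  obtain ⟨δ₂, h2, H2⟩ := hw (ε / 2) (by linarith)
  obtain ⟨P, hP⟩ := exists_taggedPartition_mesh_lt hab (lt_min h1 h2)
  have e1 := H1 P (hP.trans_le (min_le_left _ _))
  have e2 := H2 P (hP.trans_le (min_le_right _ _))
  rw [← dist_eq_norm] at e1 e2
  have := dist_triangle_left hex.choose v (RSSum x ω P)
  linarith

/-- A path whose increments agree locally with `G t (ω t - ω s)` up to a term of order larger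
than one is the Young integral of `G` against `ω`. -/
lemma IsSmallControl.isYoungIntegral {T : ℝ} {W : ℝ → ℝ → ℝ} (hW : IsSmallControl T W)
    {θ C η : ℝ} (hθ : 1 < θ) (hC : 0 ≤ C) (hη : 0 < η) {G : ℝ → E →L[ℝ] F} {ω : ℝ → E}
    {I : ℝ → F}
    (hI : ∀ s t, 0 ≤ s → s ≤ t → t ≤ T → t - s ≤ η →
      ‖I t - I s - G t (ω t - ω s)‖ ≤ C * W s t ^ θ)
    (hG : ∀ s r t, 0 ≤ s → s ≤ r → r ≤ t → t ≤ T → t - s ≤ η →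
      ‖(G t - G r) (ω t - ω s)‖ ≤ C * W s t ^ θ)
    {a b : ℝ} (ha : 0 ≤ a) (hab : a ≤ b) (hb : b ≤ T) : IsYoungIntegral G ω a b (I b - I a) := by
  intro ε hε
  have hWnn := hW.nonneg a b ha hab hb
  obtain ⟨ε', hε', -, hsm⟩ := exists_pos_mul_rpow_le
    (M := 2 * C * W a b) (by positivity) (half_pos hε) (sub_pos.2 hθ)
  obtain ⟨η', hη', Hη⟩ := hW.small ε' hε'
  refine ⟨min η η', lt_min hη hη', fun P hP => ?_⟩
  have hPa : ∀ i, a ≤ P.t i := fun i => P.first.ge.trans (P.mono.monotone (Fin.zero_le i))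
  have hPb : ∀ i, P.t i ≤ b := fun i => (P.mono.monotone (Fin.le_last i)).trans P.last.le
  have hm : ∀ i : Fin P.n, 0 ≤ P.t i.castSucc ∧ P.t i.castSucc ≤ P.t i.succ ∧ P.t i.succ ≤ T ∧
      P.t i.succ - P.t i.castSucc ≤ η ∧ P.t i.succ - P.t i.castSucc ≤ η' := fun i =>
    ⟨ha.trans (hPa _), (P.mono Fin.castSucc_lt_succ).le,
      (hPb _).trans hb,
      (P.sub_le_mesh i).trans (hP.le.trans (min_le_left _ _)),
      (P.sub_le_mesh i).trans (hP.le.trans (min_le_right _ _))⟩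
  have htel : I b - I a = ∑ i : Fin P.n, (I (P.t i.succ) - I (P.t i.castSucc)) := by
    have : ∀ (n : ℕ) (t : Fin (n + 1) → ℝ),
        ∑ i : Fin n, (I (t i.succ) - I (t i.castSucc)) = I (t (Fin.last n)) - I (t 0) := by
      intro n
      induction n with
      | zero => intro t; simp
      | succ n ih =>
        intro t
        rw [Fin.sum_univ_castSucc]
        have := ih (fun i => t i.castSucc)
        simp only [Fin.succ_last, Fin.succ_castSucc, Fin.castSucc_zero] at this ⊢
        rw [this]
        abel
    rw [this, P.first, P.last]
  have hsum := hW.sum_fin_rpow_le hθ hε'.le P.n P.t P.mono.monotone (ha.trans (hPa _)) ((hPb _).trans hb)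
    (fun i => Hη _ _ (hm i).1 (hm i).2.1 (hm i).2.2.1 (hm i).2.2.2.2)
  rw [P.first, P.last] at hsum
  refine lt_of_le_of_lt ?_ (half_lt_self hε)
  rw [htel, RSSum, ← Finset.sum_sub_distrib]
  calc _ ≤ ∑ i : Fin P.n, 2 * C * W (P.t i.castSucc) (P.t i.succ) ^ θ := by
        refine norm_sum_le_of_le _ fun i _ => ?_
        obtain ⟨h1, h2, h3, h4, -⟩ := hm i
        have e1 := hI _ _ h1 h2 h3 h4
        have e2 := hG _ (P.tag i) _ h1 (P.tag_mem i).1 (P.tag_mem i).2 h3 h4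
        set d := ω (P.t i.succ) - ω (P.t i.castSucc)
        calc ‖G (P.tag i) d - (I (P.t i.succ) - I (P.t i.castSucc))‖
            = ‖(I (P.t i.succ) - I (P.t i.castSucc) - G (P.t i.succ) d) +
              (G (P.t i.succ) - G (P.tag i)) d‖ := by
                rw [← norm_neg]; congr 1; rw [sub_apply]; abel
          _ ≤ _ := (norm_add_le _ _).trans (by linarith)
    _ = 2 * C * ∑ i : Fin P.n, W (P.t i.castSucc) (P.t i.succ) ^ θ := by rw [Finset.mul_sum]
    _ ≤ 2 * C * (ε' ^ (θ - 1) * W a b) := mul_le_mul_of_nonneg_left hsum (by positivity)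
    _ = 2 * C * W a b * ε' ^ (θ - 1) := by ring
    _ ≤ ε / 2 := hsm

end YoungIntegralLemmas

section Euler

variable {E F : Type*} [NormedAddCommGroup E] [NormedSpace ℝ E]
  [NormedAddCommGroup F] [NormedSpace ℝ F]

/-- Coefficients and driving path of a Young differential equation, with the bounds that enter
the a priori estimates expressed through a single control `W`. -/
structure IsYoungSystem (T a L G₀ β ρ : ℝ) (W : ℝ → ℝ → ℝ) (f : ℝ → F → F)
    (g : ℝ → F → (E →L[ℝ] F)) (ω : ℝ → E) : Prop where
  control : IsSmallControl T W
  sub_le : ∀ s t, 0 ≤ s → s ≤ t → t ≤ T → t - s ≤ W s t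
  a_nonneg : 0 ≤ a
  L_nonneg : 0 ≤ L
  G₀_nonneg : 0 ≤ G₀
  f_cont : ContinuousOn (fun pr : ℝ × F => f pr.1 pr.2) (Set.Icc 0 T ×ˢ Set.univ)
  f_lip : ∀ N, 0 ≤ N → ∃ M, 0 ≤ M ∧ ∀ t ∈ Set.Icc (0 : ℝ) T, ∀ x y, ‖x‖ ≤ N → ‖y‖ ≤ N →
    ‖f t x - f t y‖ ≤ M * ‖x - y‖
  f_growth : ∀ ξ s t, 0 ≤ s → s ≤ t → t ≤ T → ‖∫ r in s..t, f r ξ‖ ≤ (a * ‖ξ‖ + 1) * W s t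
  g_cont : ContinuousOn (fun pr : ℝ × F => g pr.1 pr.2) (Set.Icc 0 T ×ˢ Set.univ)
  g_lip : ∀ t ∈ Set.Icc (0 : ℝ) T, ∀ x y, ‖g t x - g t y‖ ≤ L * ‖x - y‖
  g_time : ∀ s t x, 0 ≤ s → s ≤ t → t ≤ T → ‖g t x - g s x‖ ≤ W s t ^ β
  g_zero : ∀ t ∈ Set.Icc (0 : ℝ) T, ‖g t 0‖ ≤ G₀
  ω_cont : ContinuousOn ω (Set.Icc 0 T)
  ω_le : ∀ s t, 0 ≤ s → s ≤ t → t ≤ T → ‖ω t - ω s‖ ≤ W s t ^ ρ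

/-- The backward Euler scheme along the decreasing grid `τ`. -/
def eulerScheme (f : ℝ → F → F) (g : ℝ → F → (E →L[ℝ] F)) (ω : ℝ → E) (τ : ℕ → ℝ) (ξ : F) :
    ℕ → F
  | 0 => ξ
  | k + 1 => eulerScheme f g ω τ ξ k +
      (∫ r in τ (k + 1)..τ k, f r (eulerScheme f g ω τ ξ k)) +
      g (τ k) (eulerScheme f g ω τ ξ k) (ω (τ k) - ω (τ (k + 1)))

lemma sum_Ico_le_of_superadd (w : ℕ → ℕ → ℝ) (hw0 : ∀ i j, i ≤ j → 0 ≤ w i j)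
    (hws : ∀ i j k, i ≤ j → j ≤ k → w i j + w j k ≤ w i k) {i j : ℕ} (hij : i ≤ j) :
    ∑ k ∈ Finset.Ico i j, w k (k + 1) ≤ w i j := by
  induction j, hij using Nat.le_induction with
  | base => simpa using hw0 i i le_rfl
  | succ j hij ih =>
    rw [Finset.sum_Ico_succ_top hij]
    have := hws i j (j + 1) hij (Nat.le_succ j)
    linarith

variable {T a L G₀ β ρ γ σ : ℝ} {W : ℝ → ℝ → ℝ} {f : ℝ → F → F} {g : ℝ → F → (E →L[ℝ] F)}
  {ω : ℝ → E}

/-- Increment of the diffusion coefficient along a Hölder path. -/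
lemma IsYoungSystem.norm_g_sub_le (hS : IsYoungSystem T a L G₀ β ρ W f g ω) (hσβ : σ ≤ β)
    (hσγ : σ ≤ γ) {s t K : ℝ} (hs : 0 ≤ s) (hst : s ≤ t) (ht : t ≤ T) (hW1 : W s t ≤ 1)
    (hσ : 0 < σ) (hK : 0 ≤ K)
    {x y : F} (hxy : ‖x - y‖ ≤ K * W s t ^ γ) :
    ‖g t x - g s y‖ ≤ (1 + L * K) * W s t ^ σ := by
  have hW0 := hS.control.nonneg s t hs hst ht
  have hle : ∀ κ, σ ≤ κ → W s t ^ κ ≤ W s t ^ σ := fun κ hκ => by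
    rcases hW0.eq_or_lt with h | h
    · rw [← h, Real.zero_rpow (by linarith), Real.zero_rpow hσ.ne']
    · exact Real.rpow_le_rpow_of_exponent_ge h hW1 hκ
  have hL := hS.L_nonneg
  calc ‖g t x - g s y‖ = ‖(g t x - g t y) + (g t y - g s y)‖ := by congr 1; abel
    _ ≤ L * ‖x - y‖ + W s t ^ β := (norm_add_le _ _).trans
        (add_le_add (hS.g_lip t ⟨hs.trans hst, ht⟩ x y) (hS.g_time s t y hs hst ht))
    _ ≤ L * (K * W s t ^ σ) + W s t ^ σ := by
        exact add_le_add (mul_le_mul_of_nonneg_left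
          (hxy.trans (mul_le_mul_of_nonneg_left (hle γ hσγ) hK)) hL) (hle β hσβ)
    _ = _ := by ring

lemma IsYoungSystem.euler_remainder (hS : IsYoungSystem T a L G₀ β ρ W f g ω)
    (hσ : 0 < σ) (hρ : 0 < ρ) (hσβ : σ ≤ β) (hσγ : σ ≤ γ) (hθ : 1 < σ + ρ)
    {τ : ℕ → ℝ} (hτ : Antitone τ) (hτT : ∀ k, τ k ∈ Set.Icc 0 T) (ξ : F)
    {m i₀ : ℕ} {K : ℝ} (hK : 0 ≤ K) (hW1 : W (τ m) (τ i₀) ≤ 1)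
    (hx : ∀ i j, i₀ ≤ i → i ≤ j → j ≤ m →
      ‖eulerScheme f g ω τ ξ j - eulerScheme f g ω τ ξ i‖ ≤ K * W (τ j) (τ i) ^ γ) :
    ∀ i j, i₀ ≤ i → i ≤ j → j ≤ m + 1 →
      ‖eulerScheme f g ω τ ξ j - eulerScheme f g ω τ ξ i -
        ∑ k ∈ Finset.Ico i j, (∫ r in τ (k + 1)..τ k, f r (eulerScheme f g ω τ ξ k)) -
        g (τ i) (eulerScheme f g ω τ ξ i) (ω (τ i) - ω (τ j))‖ ≤
      sewingConst (σ + ρ) * (1 + L * K) * W (τ j) (τ i) ^ (σ + ρ) := by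
  set x := eulerScheme f g ω τ ξ
  set R : ℕ → ℕ → F := fun i j => x j - x i -
    ∑ k ∈ Finset.Ico i j, (∫ r in τ (k + 1)..τ k, f r (x k)) -
    g (τ i) (x i) (ω (τ i) - ω (τ j)) with hR
  have hL := hS.L_nonneg
  have hC : 0 ≤ 1 + L * K := by positivity
  have hnn : ∀ i j, i ≤ j → 0 ≤ W (τ j) (τ i) := fun i j hij =>
    hS.control.nonneg _ _ (hτT j).1 (hτ hij) (hτT i).2
  have hmono : ∀ i i' j' j, i ≤ i' → i' ≤ j' → j' ≤ j → W (τ j') (τ i') ≤ W (τ j) (τ i) :=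
    fun i i' j' j h1 h2 h3 => hS.control.mono (hτT j).1 (hτ h3) (hτ h2) (hτ h1) (hτT i).2
  have hstep : ∀ k, R k (k + 1) = 0 := by
    intro k
    have : x (k + 1) = x k + (∫ r in τ (k + 1)..τ k, f r (x k)) +
      g (τ k) (x k) (ω (τ k) - ω (τ (k + 1))) := rfl
    simp only [hR, this, Nat.Ico_succ_singleton, Finset.sum_singleton]
    abel
  intro i j hi hij hj
  have := discrete_sewing hθ hC (a := i₀) (b := m + 1) R (fun i j => W (τ j) (τ i))
    (fun i j _ hij _ => hnn i j hij)
    (fun i j k _ hij hjk _ => by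
      have := hS.control.superadd _ _ _ (hτT k).1 (hτ hjk) (hτ hij) (hτT i).2
      linarith)
    (fun i j k hi hij hjk hk => by
      have hdec : R i k - R i j - R j k = (g (τ j) (x j) - g (τ i) (x i)) (ω (τ j) - ω (τ k)) := by
        simp only [hR]
        rw [← Finset.sum_Ico_consecutive _ hij hjk,
          show ω (τ i) - ω (τ k) = (ω (τ i) - ω (τ j)) + (ω (τ j) - ω (τ k)) by abel, map_add,
          sub_apply]
        abel
      rw [hdec]
      rcases hjk.eq_or_lt with rfl | hjk'
      · simp only [sub_self, map_zero, norm_zero]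
        exact mul_nonneg hC (Real.rpow_nonneg (hnn _ _ hij) _)
      · have hji : W (τ j) (τ i) ≤ 1 := (hmono i₀ i j m hi hij (by omega)).trans hW1
        have h1 : ‖g (τ j) (x j) - g (τ i) (x i)‖ ≤ (1 + L * K) * W (τ j) (τ i) ^ σ := by
          rw [norm_sub_rev]
          refine hS.norm_g_sub_le hσβ hσγ (hτT j).1 (hτ hij) (hτT i).2 hji hσ hK ?_
          rw [norm_sub_rev]
          exact hx i j hi hij (by omega)
        have h2 := hS.ω_le _ _ (hτT k).1 (hτ hjk) (hτT j).2
        have e1 : W (τ j) (τ i) ^ σ ≤ W (τ k) (τ i) ^ σ :=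
          Real.rpow_le_rpow (hnn i j hij) (hmono i i j k le_rfl hij hjk) hσ.le
        have e2 : W (τ k) (τ j) ^ ρ ≤ W (τ k) (τ i) ^ ρ :=
          Real.rpow_le_rpow (hnn j k hjk) (hmono i j k k hij hjk le_rfl) hρ.le
        have hnik := hnn i k (hij.trans hjk)
        calc _ ≤ ‖g (τ j) (x j) - g (τ i) (x i)‖ * ‖ω (τ j) - ω (τ k)‖ :=
              ContinuousLinearMap.le_opNorm _ _
          _ ≤ ((1 + L * K) * W (τ k) (τ i) ^ σ) * W (τ k) (τ i) ^ ρ := by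
              refine mul_le_mul (h1.trans (mul_le_mul_of_nonneg_left e1 hC)) (h2.trans e2)
                (norm_nonneg _) (mul_nonneg hC (Real.rpow_nonneg hnik _))
          _ = _ := by rw [mul_assoc, ← Real.rpow_add' hnik (by linarith)])
    i j hi hij hj
  rwa [Finset.sum_eq_zero (fun k _ => hstep k), sub_zero] at this

/-- The threshold on the size of a block in the a priori estimate of the Euler scheme. -/
def eulerGrowthConst (a L G₀ θ : ℝ) : ℝ :=
  sewingConst θ * (1 + L) + (2 * a + 1) + (G₀ + 2 * L)

lemma rpow_le_rpow_of_le_one {w κ κ' : ℝ} (hw : 0 ≤ w) (hw1 : w ≤ 1) (hκ : 0 < κ) (h : κ ≤ κ') :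
    w ^ κ' ≤ w ^ κ := by
  rcases hw.eq_or_lt with rfl | hw
  · rw [Real.zero_rpow (by linarith), Real.zero_rpow hκ.ne']
  · exact Real.rpow_le_rpow_of_exponent_ge hw hw1 h

lemma IsYoungSystem.euler_growth (hS : IsYoungSystem T a L G₀ β ρ W f g ω)
    (hσ : 0 < σ) (hσβ : σ ≤ β) (hσγ : σ ≤ γ) (hγρ : γ < ρ) (hρ1 : ρ ≤ 1) (hθ : 1 < σ + ρ)
    {τ : ℕ → ℝ} (hτ : Antitone τ) (hτT : ∀ k, τ k ∈ Set.Icc 0 T) (ξ : F) {ε : ℝ}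
    (hε1 : ε ≤ 1) (hε : eulerGrowthConst a L G₀ (σ + ρ) * ε ^ (ρ - γ) ≤ 1) {i₀ m : ℕ}
    (hm : i₀ ≤ m) (hWε : W (τ m) (τ i₀) ≤ ε) :
    ∀ i j, i₀ ≤ i → i ≤ j → j ≤ m →
      ‖eulerScheme f g ω τ ξ j - eulerScheme f g ω τ ξ i‖ ≤
        (1 + ‖eulerScheme f g ω τ ξ i₀‖) * W (τ j) (τ i) ^ γ := by
  set x := eulerScheme f g ω τ ξ
  set K := 1 + ‖x i₀‖ with hK
  have hx0 := norm_nonneg (x i₀)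
  have hK1 : 1 ≤ K := by linarith
  have hL := hS.L_nonneg
  have ha := hS.a_nonneg
  have hG := hS.G₀_nonneg
  have hγ : 0 < γ := by linarith
  have hnn : ∀ i j, i ≤ j → 0 ≤ W (τ j) (τ i) := fun i j hij =>
    hS.control.nonneg _ _ (hτT j).1 (hτ hij) (hτT i).2
  have hmono : ∀ i i' j' j, i ≤ i' → i' ≤ j' → j' ≤ j → W (τ j') (τ i') ≤ W (τ j) (τ i) :=
    fun i i' j' j h1 h2 h3 => hS.control.mono (hτT j).1 (hτ h3) (hτ h2) (hτ h1) (hτT i).2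
  have hA := (sewingConst_spec hθ).1
  induction m, hm using Nat.le_induction with
  | base =>
    intro i j hi hij hj
    obtain rfl : i = j := by omega
    rw [sub_self, norm_zero]
    exact mul_nonneg (by linarith) (Real.rpow_nonneg (hnn i i le_rfl) _)
  | succ m hm ih =>
    have hWm := (hmono i₀ i₀ m (m + 1) le_rfl hm (Nat.le_succ m)).trans hWε
    have IH := ih hWm
    have hrem := hS.euler_remainder hσ (by linarith) hσβ hσγ hθ hτ hτT ξ (by linarith : 0 ≤ K)
      (hWm.trans hε1) IH
    intro i j hi hij hj
    rcases Nat.lt_or_ge m i with him | him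
    · obtain rfl : i = j := by omega
      rw [sub_self, norm_zero]
      exact mul_nonneg (by linarith) (Real.rpow_nonneg (hnn i i le_rfl) _)
    have hR := hrem i j hi hij hj
    have hbd : ∀ k, i₀ ≤ k → k ≤ m → ‖x k‖ ≤ 2 * K := by
      intro k h1 h2
      have h3 := IH i₀ k le_rfl h1 h2
      have h4 : W (τ k) (τ i₀) ^ γ ≤ 1 := Real.rpow_le_one (hnn _ _ h1)
        (((hmono i₀ i₀ k m le_rfl h1 h2).trans hWm).trans hε1) hγ.le
      have h5 : K * W (τ k) (τ i₀) ^ γ ≤ K := mul_le_of_le_one_right (by linarith) h4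
      have h6 := norm_le_norm_add_norm_sub' (x k) (x i₀)
      linarith
    set w := W (τ j) (τ i) with hw
    have hw0 : 0 ≤ w := hnn i j hij
    have hwε : w ≤ ε := (hmono i₀ i j (m + 1) hi hij hj).trans hWε
    have hw1 := hwε.trans hε1
    have hFsum : ‖∑ k ∈ Finset.Ico i j, (∫ r in τ (k + 1)..τ k, f r (x k))‖ ≤
        ((2 * a + 1) * K) * w := by
      calc _ ≤ ∑ k ∈ Finset.Ico i j, ((2 * a + 1) * K) * W (τ (k + 1)) (τ k) := by
            refine norm_sum_le_of_le _ fun k hk => ?_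
            rw [Finset.mem_Ico] at hk
            refine (hS.f_growth (x k) _ _ (hτT _).1 (hτ (Nat.le_succ k)) (hτT _).2).trans ?_
            refine mul_le_mul_of_nonneg_right ?_ (hnn k (k + 1) (Nat.le_succ k))
            have := mul_le_mul_of_nonneg_left (hbd k (by omega) (by omega)) ha
            linarith
        _ = ((2 * a + 1) * K) * ∑ k ∈ Finset.Ico i j, W (τ (k + 1)) (τ k) := by
            rw [Finset.mul_sum]
        _ ≤ _ := by
            refine mul_le_mul_of_nonneg_left ?_ (by positivity)
            exact sum_Ico_le_of_superadd (fun i j => W (τ j) (τ i)) hnn (fun i j k hij hjk => by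
              have := hS.control.superadd _ _ _ (hτT k).1 (hτ hjk) (hτ hij) (hτT i).2
              linarith) hij
    have hgω : ‖g (τ i) (x i) (ω (τ i) - ω (τ j))‖ ≤ ((G₀ + 2 * L) * K) * w ^ ρ := by
      have h1 : ‖g (τ i) (x i)‖ ≤ (G₀ + 2 * L) * K := by
        have e1 := hS.g_lip (τ i) (hτT i) (x i) 0
        have e2 := hS.g_zero (τ i) (hτT i)
        have e3 := norm_le_norm_add_norm_sub' (g (τ i) (x i)) (g (τ i) 0)
        rw [sub_zero] at e1
        have e4 := mul_le_mul_of_nonneg_left (hbd i hi him) hL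
        have e5 : G₀ ≤ G₀ * K := le_mul_of_one_le_right hG hK1
        linarith
      refine (ContinuousLinearMap.le_opNorm _ _).trans ?_
      exact mul_le_mul h1 (hS.ω_le _ _ (hτT j).1 (hτ hij) (hτT i).2) (norm_nonneg _)
        (by positivity)
    have e1 : w ≤ w ^ ρ := by
      simpa using rpow_le_rpow_of_le_one (κ' := 1) hw0 hw1 (by linarith : 0 < ρ) hρ1
    have e2 : w ^ (σ + ρ) ≤ w ^ ρ := rpow_le_rpow_of_le_one hw0 hw1 (by linarith) (by linarith)
    have e3 : w ^ ρ ≤ ε ^ (ρ - γ) * w ^ γ := by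
      rw [show ρ = (ρ - γ) + γ by ring, Real.rpow_add' hw0 (by linarith), add_sub_cancel_right]
      gcongr
    have e4 : sewingConst (σ + ρ) * (1 + L * K) ≤ sewingConst (σ + ρ) * (1 + L) * K := by
      have : 1 + L * K ≤ (1 + L) * K := by linarith
      calc _ ≤ sewingConst (σ + ρ) * ((1 + L) * K) := by gcongr
        _ = _ := by ring
    calc ‖x j - x i‖ = ‖(x j - x i - ∑ k ∈ Finset.Ico i j, (∫ r in τ (k + 1)..τ k, f r (x k)) -
          g (τ i) (x i) (ω (τ i) - ω (τ j))) +
          ∑ k ∈ Finset.Ico i j, (∫ r in τ (k + 1)..τ k, f r (x k)) +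
          g (τ i) (x i) (ω (τ i) - ω (τ j))‖ := by congr 1; abel
      _ ≤ sewingConst (σ + ρ) * (1 + L * K) * w ^ (σ + ρ) + ((2 * a + 1) * K) * w +
          ((G₀ + 2 * L) * K) * w ^ ρ := norm_add₃_le.trans
            (add_le_add (add_le_add hR hFsum) hgω)
      _ ≤ (sewingConst (σ + ρ) * (1 + L) * K) * w ^ ρ + ((2 * a + 1) * K) * w ^ ρ +
          ((G₀ + 2 * L) * K) * w ^ ρ := by
          gcongr
      _ = K * (eulerGrowthConst a L G₀ (σ + ρ) * w ^ ρ) := by rw [eulerGrowthConst]; ring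
      _ ≤ K * (eulerGrowthConst a L G₀ (σ + ρ) * (ε ^ (ρ - γ) * w ^ γ)) := by
          have : 0 ≤ eulerGrowthConst a L G₀ (σ + ρ) := by rw [eulerGrowthConst]; positivity
          gcongr
      _ = (eulerGrowthConst a L G₀ (σ + ρ) * ε ^ (ρ - γ)) * (K * w ^ γ) := by ring
      _ ≤ K * w ^ γ := mul_le_of_le_one_left (by positivity) hε

end Euler

section EulerLimit

variable {E F : Type*} [NormedAddCommGroup E] [NormedSpace ℝ E]
  [NormedAddCommGroup F] [NormedSpace ℝ F]
  {T a L G₀ β ρ γ σ : ℝ} {W : ℝ → ℝ → ℝ} {f : ℝ → F → F} {g : ℝ → F → (E →L[ℝ] F)}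
  {ω : ℝ → E}

lemma IsYoungSystem.f_intervalIntegrable (hS : IsYoungSystem T a L G₀ β ρ W f g ω) (ξ : F)
    {s t : ℝ} (hs : s ∈ Set.Icc 0 T) (ht : t ∈ Set.Icc 0 T) :
    IntervalIntegrable (fun r => f r ξ) MeasureTheory.volume s t := by
  refine ContinuousOn.intervalIntegrable ?_
  refine hS.f_cont.comp (f := fun r : ℝ => (r, ξ)) (by fun_prop) fun r hr => ⟨?_, Set.mem_univ _⟩
  exact Set.uIcc_subset_Icc hs ht hr

lemma IsYoungSystem.euler_bounded (hS : IsYoungSystem T a L G₀ β ρ W f g ω)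
    (hσ : 0 < σ) (hσβ : σ ≤ β) (hσγ : σ ≤ γ) (hγρ : γ < ρ) (hρ1 : ρ ≤ 1) (hθ : 1 < σ + ρ)
    {τ : ℕ → ℝ} (hτ : Antitone τ) (hτT : ∀ k, τ k ∈ Set.Icc 0 T) (ξ : F) {ε η : ℝ}
    (hε1 : ε ≤ 1) (hε : eulerGrowthConst a L G₀ (σ + ρ) * ε ^ (ρ - γ) ≤ 1)
    (hηε : ∀ s t, 0 ≤ s → s ≤ t → t ≤ T → t - s ≤ η → W s t ≤ ε)
    (hτ0 : τ 0 = T) (hstep : ∀ k, τ k - τ (k + 1) ≤ η / 2) (hη : 0 < η) (j : ℕ) :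
    ∀ k, T - τ k ≤ j * (η / 2) →
      1 + ‖eulerScheme f g ω τ ξ k‖ ≤ 2 ^ (j + 1) * (1 + ‖ξ‖) := by
  have key : ∀ i k, i ≤ k → τ i - τ k ≤ η →
      1 + ‖eulerScheme f g ω τ ξ k‖ ≤ 2 * (1 + ‖eulerScheme f g ω τ ξ i‖) := by
    intro i k hik h
    have hw := hηε _ _ (hτT k).1 (hτ hik) (hτT i).2 h
    have h1 := hS.euler_growth hσ hσβ hσγ hγρ hρ1 hθ hτ hτT ξ hε1 hε hik hw i k le_rfl hik le_rfl
    have h2 : W (τ k) (τ i) ^ γ ≤ 1 := Real.rpow_le_one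
      (hS.control.nonneg _ _ (hτT k).1 (hτ hik) (hτT i).2) (hw.trans hε1) (by linarith)
    have h3 := mul_le_of_le_one_right (b := W (τ k) (τ i) ^ γ)
      (by positivity : 0 ≤ 1 + ‖eulerScheme f g ω τ ξ i‖) h2
    have h4 := norm_le_norm_add_norm_sub' (eulerScheme f g ω τ ξ k) (eulerScheme f g ω τ ξ i)
    linarith
  induction j with
  | zero =>
    intro k hk
    have := key 0 k (Nat.zero_le k) (by rw [hτ0]; push_cast at hk; linarith)
    simpa [eulerScheme] using this
  | succ j ih =>
    intro k hk
    have hex : ∃ i, τ i - τ k ≤ η := ⟨k, by simp [hη.le]⟩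
    classical
    have h1 := Nat.find_spec hex
    have h2 : Nat.find hex ≤ k := Nat.find_min' hex (by simp [hη.le])
    have h3 := key _ _ h2 h1
    rcases hi : Nat.find hex with _ | i
    · rw [hi] at h3
      refine h3.trans ?_
      have : (2 : ℝ) ^ 1 ≤ 2 ^ (j + 1 + 1) := pow_le_pow_right₀ (by norm_num) (by omega)
      exact mul_le_mul_of_nonneg_right (by linarith) (by positivity)
    · have h4 := Nat.find_min hex (m := i) (by omega)
      rw [hi] at h3
      have h5 := hstep i
      have := ih (i + 1) (by push_cast at hk; linarith)
      calc _ ≤ _ := h3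
        _ ≤ 2 * (2 ^ (j + 1) * (1 + ‖ξ‖)) := by linarith
        _ = _ := by ring

lemma IsYoungSystem.exists_euler_estimates (hS : IsYoungSystem T a L G₀ β ρ W f g ω)
    (hσ : 0 < σ) (hσβ : σ ≤ β) (hσγ : σ ≤ γ) (hγρ : γ < ρ) (hρ1 : ρ ≤ 1) (hθ : 1 < σ + ρ)
    (ξ : F) :
    ∃ N C η : ℝ, 0 ≤ N ∧ 0 ≤ C ∧ 0 < η ∧
      (∀ s t, 0 ≤ s → s ≤ t → t ≤ T → t - s ≤ η → W s t ≤ 1) ∧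
      ∀ τ : ℕ → ℝ, Antitone τ → (∀ k, τ k ∈ Set.Icc 0 T) → τ 0 = T →
        (∀ k, τ k - τ (k + 1) ≤ η / 2) →
        (∀ k, ‖eulerScheme f g ω τ ξ k‖ ≤ N) ∧
        ∀ i j, i ≤ j → τ i - τ j ≤ η →
          ‖eulerScheme f g ω τ ξ j - eulerScheme f g ω τ ξ i‖ ≤ (1 + N) * W (τ j) (τ i) ^ γ ∧
          ‖eulerScheme f g ω τ ξ j - eulerScheme f g ω τ ξ i -
            (∫ r in τ j..τ i, f r (eulerScheme f g ω τ ξ i)) -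
            g (τ i) (eulerScheme f g ω τ ξ i) (ω (τ i) - ω (τ j))‖ ≤
              C * W (τ j) (τ i) ^ (σ + ρ) := by
  have hA := (sewingConst_spec hθ).1
  have hL := hS.L_nonneg
  have hM0 : 0 ≤ eulerGrowthConst a L G₀ (σ + ρ) := by
    have := hS.a_nonneg
    have := hS.G₀_nonneg
    rw [eulerGrowthConst]
    positivity
  obtain ⟨ε, hε0, hε1, hε⟩ := exists_pos_mul_rpow_le hM0 one_pos (sub_pos.2 hγρ)
  obtain ⟨η, hη, hηε⟩ := hS.control.small ε hε0
  set J := ⌈T / (η / 2)⌉₊ with hJ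
  set N := 2 ^ (J + 1) * (1 + ‖ξ‖)
  have hN0 : 0 ≤ N := by positivity
  obtain ⟨M, hM, hlip⟩ := hS.f_lip N hN0
  have hγ : 0 < γ := by linarith
  refine ⟨N, sewingConst (σ + ρ) * (1 + L * (1 + N)) + M * (1 + N), η, hN0, by positivity, hη,
    fun s t hs hst ht h => (hηε s t hs hst ht h).trans hε1, ?_⟩
  intro τ hτ hτT hτ0 hstep
  set x := eulerScheme f g ω τ ξ with hx
  have hbd : ∀ k, ‖x k‖ ≤ N := by
    intro k
    have := hS.euler_bounded hσ hσβ hσγ hγρ hρ1 hθ hτ hτT ξ hε1 hε hηε hτ0 hstep hη J k (by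
      have h1 := Nat.le_ceil (T / (η / 2))
      rw [div_le_iff₀ (by linarith), ← hJ] at h1
      have := (hτT k).1
      linarith)
    linarith
  refine ⟨hbd, fun i j hij hle => ?_⟩
  have hwε := hηε _ _ (hτT j).1 (hτ hij) (hτT i).2 hle
  have hgrow : ∀ i' j', i ≤ i' → i' ≤ j' → j' ≤ j →
      ‖x j' - x i'‖ ≤ (1 + N) * W (τ j') (τ i') ^ γ := by
    intro i' j' h1 h2 h3
    refine (hS.euler_growth hσ hσβ hσγ hγρ hρ1 hθ hτ hτT ξ hε1 hε hij hwε i' j' h1 h2 h3).trans ?_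
    have := hS.control.nonneg _ _ (hτT j').1 (hτ h2) (hτT i').2
    have := hbd i
    gcongr
  refine ⟨hgrow i j le_rfl hij le_rfl, ?_⟩
  have hrem := hS.euler_remainder hσ (by linarith) hσβ hσγ hθ hτ hτT ξ
    (by linarith : 0 ≤ 1 + N) (hwε.trans hε1) hgrow i j le_rfl hij (by omega)
  rw [← hx] at hrem
  set w := W (τ j) (τ i) with hw
  have hw0 : 0 ≤ w := hS.control.nonneg _ _ (hτT j).1 (hτ hij) (hτT i).2
  have hint : (∫ r in τ j..τ i, f r (x i)) =
      ∑ k ∈ Finset.Ico i j, ∫ r in τ (k + 1)..τ k, f r (x i) := by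
    have := intervalIntegral.sum_integral_adjacent_intervals_Ico (f := fun r => f r (x i))
      (μ := MeasureTheory.volume) (a := τ) hij
      (fun k _ => hS.f_intervalIntegrable _ (hτT _) (hτT _))
    rw [intervalIntegral.integral_symm, ← this, ← Finset.sum_neg_distrib]
    exact Finset.sum_congr rfl fun k _ => (intervalIntegral.integral_symm _ _).symm
  have hdiff : ‖∑ k ∈ Finset.Ico i j, (∫ r in τ (k + 1)..τ k, f r (x k)) -
      ∫ r in τ j..τ i, f r (x i)‖ ≤ M * (1 + N) * w ^ (σ + ρ) := by
    rw [hint, ← Finset.sum_sub_distrib]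
    calc _ ≤ ∑ k ∈ Finset.Ico i j, (M * ((1 + N) * w ^ γ)) * (τ k - τ (k + 1)) := by
          refine norm_sum_le_of_le _ fun k hk => ?_
          rw [Finset.mem_Ico] at hk
          rw [← intervalIntegral.integral_sub (hS.f_intervalIntegrable _ (hτT _) (hτT _))
            (hS.f_intervalIntegrable _ (hτT _) (hτT _)),
            ← abs_of_nonneg (sub_nonneg.2 (hτ (Nat.le_succ k)))]
          refine intervalIntegral.norm_integral_le_of_norm_le_const fun r hr => ?_
          rw [Set.uIoc_of_le (hτ (Nat.le_succ k))] at hr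
          refine (hlip r ⟨(hτT _).1.trans hr.1.le, hr.2.trans (hτT _).2⟩ _ _ (hbd k)
            (hbd i)).trans ?_
          refine mul_le_mul_of_nonneg_left ((hgrow i k le_rfl hk.1 hk.2.le).trans ?_) hM
          refine mul_le_mul_of_nonneg_left (Real.rpow_le_rpow ?_ ?_ hγ.le) (by linarith)
          · exact hS.control.nonneg _ _ (hτT k).1 (hτ hk.1) (hτT i).2
          · exact hS.control.mono (hτT j).1 (hτ hk.2.le) (hτ hk.1) le_rfl (hτT i).2
      _ = (M * ((1 + N) * w ^ γ)) * (τ i - τ j) := by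
          rw [← Finset.mul_sum]
          congr 1
          have := Finset.sum_Ico_sub τ hij
          rw [← neg_sub (τ j), ← this, ← Finset.sum_neg_distrib]
          exact Finset.sum_congr rfl fun k _ => by ring
      _ ≤ (M * ((1 + N) * w ^ γ)) * w :=
          mul_le_mul_of_nonneg_left (hS.sub_le _ _ (hτT j).1 (hτ hij) (hτT i).2) (by positivity)
      _ = M * (1 + N) * w ^ (γ + 1) := by
          rw [Real.rpow_add' hw0 (by linarith), Real.rpow_one]; ring
      _ ≤ _ := mul_le_mul_of_nonneg_left
          (rpow_le_rpow_of_le_one hw0 (hwε.trans hε1) (by linarith) (by linarith)) (by positivity)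
  calc _ = ‖(x j - x i - ∑ k ∈ Finset.Ico i j, (∫ r in τ (k + 1)..τ k, f r (x k)) -
        g (τ i) (x i) (ω (τ i) - ω (τ j))) +
        (∑ k ∈ Finset.Ico i j, (∫ r in τ (k + 1)..τ k, f r (x k)) -
          ∫ r in τ j..τ i, f r (x i))‖ := by congr 1; abel
    _ ≤ _ := (norm_add_le _ _).trans (add_le_add hrem hdiff)
    _ = _ := by ring

end EulerLimit

section YoungSolution

variable {E F : Type*} [NormedAddCommGroup E] [NormedSpace ℝ E]
  [NormedAddCommGroup F] [NormedSpace ℝ F]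
  {T a L G₀ β ρ γ σ : ℝ} {W : ℝ → ℝ → ℝ} {f : ℝ → F → F} {g : ℝ → F → (E →L[ℝ] F)}
  {ω : ℝ → E}

open Filter Topology in
lemma IsYoungSystem.tendsto_integral (hS : IsYoungSystem T a L G₀ β ρ W f g ω)
    {ι : Type*} {l : Filter ι} {u v : ι → ℝ} {z : ι → F} {s t : ℝ} {ζ : F}
    (hs : s ∈ Set.Icc 0 T) (ht : t ∈ Set.Icc 0 T) (hu : ∀ n, u n ∈ Set.Icc 0 T)
    (hv : ∀ n, v n ∈ Set.Icc 0 T) (hus : Tendsto u l (𝓝 s)) (hvt : Tendsto v l (𝓝 t))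
    (hz : Tendsto z l (𝓝 ζ)) :
    Tendsto (fun n => ∫ r in u n..v n, f r (z n)) l (𝓝 (∫ r in s..t, f r ζ)) := by
  have h0 : (0 : ℝ) ∈ Set.Icc 0 T := ⟨le_rfl, hs.1.trans hs.2⟩
  have hT0 : (0 : ℝ) ≤ T := h0.2
  have hTT : T ∈ Set.Icc 0 T := ⟨hT0, le_rfl⟩
  set P : ℝ → F := fun r => ∫ y in (0 : ℝ)..r, f y ζ with hP
  have hPc : ContinuousOn P (Set.Icc 0 T) := by
    have := intervalIntegral.continuousOn_primitive_interval'
      (hS.f_intervalIntegrable ζ h0 hTT) (a := 0) (by simp)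
    rwa [Set.uIcc_of_le hT0] at this
  have hPsub : ∀ x y, x ∈ Set.Icc 0 T → y ∈ Set.Icc 0 T → ∫ r in x..y, f r ζ = P y - P x :=
    fun x y hx hy => (intervalIntegral.integral_interval_sub_left
      (hS.f_intervalIntegrable ζ h0 hy) (hS.f_intervalIntegrable ζ h0 hx)).symm
  have hP1 : Tendsto (fun n => P (v n) - P (u n)) l (𝓝 (P t - P s)) :=
    ((hPc t ht).tendsto.comp (tendsto_nhdsWithin_iff.2 ⟨hvt, .of_forall hv⟩)).sub
      ((hPc s hs).tendsto.comp (tendsto_nhdsWithin_iff.2 ⟨hus, .of_forall hu⟩))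
  obtain ⟨M, hM, hlip⟩ := hS.f_lip (‖ζ‖ + 1) (by positivity)
  have hE : Tendsto (fun n => (∫ r in u n..v n, f r (z n)) - ∫ r in u n..v n, f r ζ) l (𝓝 0) := by
    refine squeeze_zero_norm' (a := fun n => M * ‖z n - ζ‖ * T) ?_ ?_
    · have hev : ∀ᶠ n in l, ‖z n‖ ≤ ‖ζ‖ + 1 := by
        filter_upwards [hz.norm.eventually (gt_mem_nhds (lt_add_one ‖ζ‖))] with n hn using hn.le
      filter_upwards [hev] with n hn
      rw [← intervalIntegral.integral_sub (hS.f_intervalIntegrable _ (hu n) (hv n))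
        (hS.f_intervalIntegrable _ (hu n) (hv n))]
      have h1 : |v n - u n| ≤ T := abs_sub_le_iff.2
        ⟨by linarith [(hv n).2, (hu n).1], by linarith [(hu n).2, (hv n).1]⟩
      refine (intervalIntegral.norm_integral_le_of_norm_le_const (C := M * ‖z n - ζ‖)
        fun r hr => ?_).trans (mul_le_mul_of_nonneg_left h1 (by positivity))
      exact hlip r (Set.uIcc_subset_Icc (hu n) (hv n) (Set.uIoc_subset_uIcc hr)) _ _ hn
        (by linarith)
    · have h1 : Tendsto (fun n => z n - ζ) l (𝓝 0) := by simpa using hz.sub_const ζ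
      simpa using (h1.norm.const_mul M).mul_const T
  have := hE.add hP1
  rw [zero_add] at this
  rw [hPsub s t hs ht]
  refine this.congr fun n => ?_
  rw [hPsub _ _ (hu n) (hv n)]
  abel

/-- The uniform grid of mesh `T / (n + 1)` of `[0, T]`, listed from `T` downwards. -/
def backwardGrid (T : ℝ) (n k : ℕ) : ℝ := max 0 (T - k * (T / (n + 1)))

/-- The index of the last point of the uniform grid that is not below `t`. -/
def backwardIndex (T : ℝ) (n : ℕ) (t : ℝ) : ℕ := ⌊(T - t) / (T / (n + 1))⌋₊

lemma backwardGrid_antitone (hT : 0 ≤ T) (n : ℕ) : Antitone (backwardGrid T n) := by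
  intro i j hij
  have : (i : ℝ) ≤ j := by exact_mod_cast hij
  unfold backwardGrid
  gcongr

lemma backwardGrid_mem (hT : 0 ≤ T) (n k : ℕ) : backwardGrid T n k ∈ Set.Icc 0 T := by
  refine ⟨le_max_left _ _, max_le hT ?_⟩
  have : 0 ≤ k * (T / (n + 1)) := by positivity
  linarith

lemma backwardGrid_zero (hT : 0 ≤ T) (n : ℕ) : backwardGrid T n 0 = T := by
  simp [backwardGrid, hT]

lemma backwardGrid_sub_succ_le (hT : 0 ≤ T) (n k : ℕ) :
    backwardGrid T n k - backwardGrid T n (k + 1) ≤ T / (n + 1) := by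
  have h0 : 0 ≤ T / (n + 1) := by positivity
  unfold backwardGrid
  push_cast
  rcases max_cases 0 (T - k * (T / (n + 1))) with h | h
  · have := le_max_left 0 (T - (k + 1) * (T / (n + 1)))
    linarith
  · have := le_max_right 0 (T - (k + 1) * (T / (n + 1)))
    linarith

lemma le_backwardGrid_backwardIndex (hT : 0 < T) (n : ℕ) {t : ℝ} (ht : t ≤ T) :
    t ≤ backwardGrid T n (backwardIndex T n t) := by
  have h0 : 0 < T / (n + 1) := by positivity
  have := Nat.floor_le (div_nonneg (sub_nonneg.2 ht) h0.le)
  rw [le_div_iff₀ h0] at this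
  refine le_max_of_le_right ?_
  unfold backwardIndex
  linarith

lemma backwardGrid_backwardIndex_succ_le (hT : 0 < T) (n : ℕ) {t : ℝ} (ht : 0 ≤ t) :
    backwardGrid T n (backwardIndex T n t + 1) ≤ t := by
  have h0 : 0 < T / (n + 1) := by positivity
  have := Nat.lt_floor_add_one ((T - t) / (T / (n + 1)))
  rw [div_lt_iff₀ h0] at this
  refine max_le ht ?_
  unfold backwardIndex
  push_cast
  linarith

lemma backwardIndex_lt (hT : 0 < T) (n : ℕ) {s t : ℝ} (ht : t ≤ T)
    (hst : T / (n + 1) ≤ t - s) : backwardIndex T n t < backwardIndex T n s := by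
  have h0 : 0 < T / (n + 1) := by positivity
  refine Nat.succ_le_iff.1 (Nat.le_floor ?_)
  have := Nat.floor_le (div_nonneg (sub_nonneg.2 ht) h0.le)
  rw [le_div_iff₀ h0] at this
  unfold backwardIndex
  push_cast
  rw [le_div_iff₀ h0]
  linarith

open Filter Topology in
lemma IsYoungSystem.exists_local_solution [ProperSpace F]
    (hS : IsYoungSystem T a L G₀ β ρ W f g ω)
    (hσ : 0 < σ) (hσβ : σ ≤ β) (hσγ : σ ≤ γ) (hγρ : γ < ρ) (hρ1 : ρ ≤ 1) (hθ : 1 < σ + ρ)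
    (hT : 0 < T) (ξ : F) :
    ∃ (x : ℝ → F) (N C η : ℝ), 0 ≤ N ∧ 0 ≤ C ∧ 0 < η ∧ x T = ξ ∧
      (∀ s t, 0 ≤ s → s ≤ t → t ≤ T → t - s ≤ η → W s t ≤ 1) ∧
      (∀ t ∈ Set.Icc 0 T, ‖x t‖ ≤ N) ∧
      ∀ s t, 0 ≤ s → s ≤ t → t ≤ T → t - s ≤ η →
        ‖x s - x t‖ ≤ (1 + N) * W s t ^ γ ∧
        ‖x s - x t - (∫ r in s..t, f r (x t)) - g t (x t) (ω t - ω s)‖ ≤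
          C * W s t ^ (σ + ρ) := by
  have hγ : 0 < γ := by linarith
  obtain ⟨N, C, η, hN, hC, hη, hW1, hest⟩ :=
    hS.exists_euler_estimates hσ hσβ hσγ hγρ hρ1 hθ ξ
  set τ := backwardGrid T with hτ
  have hτT : ∀ n k, τ n k ∈ Set.Icc 0 T := backwardGrid_mem hT.le
  have hmesh : Tendsto (fun n : ℕ => T / (n + 1 : ℝ)) atTop (𝓝 0) := by
    simpa using (tendsto_one_div_add_atTop_nhds_zero_nat (𝕜 := ℝ)).const_mul T |>.congr
      fun n => by ring
  have hmesh' : ∀ κ, 0 < κ → ∀ᶠ n : ℕ in atTop, T / (n + 1 : ℝ) ≤ κ := fun κ hκ =>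
    (hmesh.eventually (gt_mem_nhds hκ)).mono fun n hn => hn.le
  have hestn : ∀ᶠ n in atTop, (∀ k, ‖eulerScheme f g ω (τ n) ξ k‖ ≤ N) ∧ ∀ i j, i ≤ j →
      τ n i - τ n j ≤ η →
        ‖eulerScheme f g ω (τ n) ξ j - eulerScheme f g ω (τ n) ξ i‖ ≤
          (1 + N) * W (τ n j) (τ n i) ^ γ ∧
        ‖eulerScheme f g ω (τ n) ξ j - eulerScheme f g ω (τ n) ξ i -
          (∫ r in τ n j..τ n i, f r (eulerScheme f g ω (τ n) ξ i)) -
          g (τ n i) (eulerScheme f g ω (τ n) ξ i) (ω (τ n i) - ω (τ n j))‖ ≤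
            C * W (τ n j) (τ n i) ^ (σ + ρ) := by
    filter_upwards [hmesh' (η / 2) (by positivity)] with n hn
    exact hest (τ n) (backwardGrid_antitone hT.le n) (hτT n) (backwardGrid_zero hT.le n)
      fun k => (backwardGrid_sub_succ_le hT.le n k).trans hn
  set U : Ultrafilter ℕ := Filter.hyperfilter ℕ
  have hUle : (U : Filter ℕ) ≤ atTop := Nat.hyperfilter_le_atTop
  set κ := backwardIndex T with hκ
  have hlim : ∀ t, ∃ y, Tendsto (fun n => eulerScheme f g ω (τ n) ξ (κ n t)) U (𝓝 y) :=
    fun t => exists_tendsto_of_eventually_norm_le U (B := N)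
      ((hestn.filter_mono hUle).mono fun n hn => hn.1 _)
  choose x hx using hlim
  have hτ1 : ∀ t ∈ Set.Icc 0 T, Tendsto (fun n => τ n (κ n t)) atTop (𝓝 t) := by
    intro t ht
    have : Tendsto (fun n : ℕ => t + T / (n + 1 : ℝ)) atTop (𝓝 t) := by
      simpa using hmesh.const_add t
    refine tendsto_of_tendsto_of_tendsto_of_le_of_le tendsto_const_nhds this
      (fun n => le_backwardGrid_backwardIndex hT n ht.2) fun n => ?_
    have h1 := backwardGrid_sub_succ_le hT.le n (κ n t)
    have h2 := backwardGrid_backwardIndex_succ_le hT n ht.1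
    simp only [hτ, hκ] at *
    linarith
  have hτ2 : ∀ t ∈ Set.Icc 0 T, Tendsto (fun n => τ n (κ n t + 1)) atTop (𝓝 t) := by
    intro t ht
    have : Tendsto (fun n : ℕ => t - T / (n + 1 : ℝ)) atTop (𝓝 t) := by
      simpa using hmesh.const_sub t
    refine tendsto_of_tendsto_of_tendsto_of_le_of_le this tendsto_const_nhds (fun n => ?_)
      (fun n => backwardGrid_backwardIndex_succ_le hT n ht.1)
    have h1 := backwardGrid_sub_succ_le hT.le n (κ n t)
    have h2 := le_backwardGrid_backwardIndex hT n ht.2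
    simp only [hτ, hκ] at *
    linarith
  have hx' : ∀ t, Tendsto (fun n => eulerScheme f g ω (τ n) ξ (κ n t + 1)) U (𝓝 (x t)) := by
    intro t
    have hd : Tendsto (fun n => eulerScheme f g ω (τ n) ξ (κ n t + 1) -
        eulerScheme f g ω (τ n) ξ (κ n t)) atTop (𝓝 0) := by
      rw [NormedAddGroup.tendsto_nhds_zero]
      intro e he
      obtain ⟨ε', hε'0, hε'1, hε'⟩ := exists_pos_mul_rpow_le
        (by linarith : 0 ≤ 1 + N) (half_pos he) hγ
      obtain ⟨η', hη', hηε'⟩ := hS.control.small ε' hε'0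
      filter_upwards [hestn, hmesh' (min η η') (lt_min hη hη')] with n hn hm
      have h1 := backwardGrid_sub_succ_le hT.le n (κ n t)
      have h2 := ((hn.2 (κ n t) (κ n t + 1) (Nat.le_succ _)
        (h1.trans (hm.trans (min_le_left _ _)))).1)
      have h3 := backwardGrid_antitone hT.le n (Nat.le_succ (κ n t))
      have h4 := hηε' _ _ (hτT n _).1 h3 (hτT n _).2 (h1.trans (hm.trans (min_le_right _ _)))
      have h5 := Real.rpow_le_rpow (hS.control.nonneg _ _ (hτT n _).1 h3 (hτT n _).2) h4 hγ.le
      have h6 := mul_le_mul_of_nonneg_left h5 (by linarith : 0 ≤ 1 + N)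
      linarith
    simpa using (hd.mono_left hUle).add (hx t)
  have hbd : ∀ t, ‖x t‖ ≤ N := fun t => le_of_tendsto (hx t).norm
    ((hestn.filter_mono hUle).mono fun n hn => hn.1 _)
  refine ⟨x, N, C, η, hN, hC, hη, ?_, hW1, fun t _ => hbd t, ?_⟩
  · refine tendsto_nhds_unique (hx T) (tendsto_const_nhds.congr fun n => ?_)
    simp [hκ, backwardIndex, eulerScheme]
  intro s t hs hst ht hle
  have hW0 := hS.control.nonneg s t hs hst ht
  have hsT : s ∈ Set.Icc 0 T := ⟨hs, hst.trans ht⟩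
  have htT : t ∈ Set.Icc 0 T := ⟨hs.trans hst, ht⟩
  rcases hst.eq_or_lt with rfl | hlt
  · simp only [sub_self, norm_zero, intervalIntegral.integral_same, map_zero]
    exact ⟨mul_nonneg (by linarith) (Real.rpow_nonneg hW0 _),
      mul_nonneg hC (Real.rpow_nonneg hW0 _)⟩
  have hev : ∀ᶠ n in (U : Filter ℕ),
      ‖eulerScheme f g ω (τ n) ξ (κ n s) - eulerScheme f g ω (τ n) ξ (κ n t + 1)‖ ≤
          (1 + N) * W s t ^ γ ∧
        ‖eulerScheme f g ω (τ n) ξ (κ n s) - eulerScheme f g ω (τ n) ξ (κ n t + 1) -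
          (∫ r in τ n (κ n s)..τ n (κ n t + 1), f r (eulerScheme f g ω (τ n) ξ (κ n t + 1))) -
          g (τ n (κ n t + 1)) (eulerScheme f g ω (τ n) ξ (κ n t + 1))
            (ω (τ n (κ n t + 1)) - ω (τ n (κ n s)))‖ ≤ C * W s t ^ (σ + ρ) := by
    filter_upwards [hestn.filter_mono hUle, (hmesh' (t - s) (sub_pos.2 hlt)).filter_mono hUle]
      with n hn hm
    have h1 := Nat.succ_le_iff.2 (backwardIndex_lt hT n ht hm)
    have h2 : τ n (κ n t + 1) ≤ t := backwardGrid_backwardIndex_succ_le hT n htT.1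
    have h3 : s ≤ τ n (κ n s) := le_backwardGrid_backwardIndex hT n hsT.2
    have h4 := backwardGrid_antitone hT.le n h1
    have h5 := hS.control.mono hs h3 h4 h2 ht
    have h6 := hS.control.nonneg _ _ (hτT n (κ n s)).1 h4 (hτT n (κ n t + 1)).2
    have h7 := hn.2 _ _ h1 (by linarith)
    exact ⟨h7.1.trans (mul_le_mul_of_nonneg_left (Real.rpow_le_rpow h6 h5 hγ.le) (by linarith)),
      h7.2.trans (mul_le_mul_of_nonneg_left (Real.rpow_le_rpow h6 h5 (by linarith)) hC)⟩
  have hcg : Tendsto (fun n => g (τ n (κ n t + 1)) (eulerScheme f g ω (τ n) ξ (κ n t + 1))) U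
      (𝓝 (g t (x t))) :=
    (hS.g_cont (t, x t) ⟨htT, Set.mem_univ _⟩).tendsto.comp
      (f := fun n => (τ n (κ n t + 1), eulerScheme f g ω (τ n) ξ (κ n t + 1)))
      (tendsto_nhdsWithin_iff.2 ⟨((hτ2 t htT).mono_left hUle).prodMk_nhds (hx' t),
        .of_forall fun n => ⟨hτT n _, Set.mem_univ _⟩⟩)
  have hcω : Tendsto (fun n => ω (τ n (κ n t + 1)) - ω (τ n (κ n s))) U (𝓝 (ω t - ω s)) :=
    ((hS.ω_cont t htT).tendsto.comp (tendsto_nhdsWithin_iff.2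
      ⟨(hτ2 t htT).mono_left hUle, .of_forall fun n => hτT n _⟩)).sub
    ((hS.ω_cont s hsT).tendsto.comp (tendsto_nhdsWithin_iff.2
      ⟨(hτ1 s hsT).mono_left hUle, .of_forall fun n => hτT n _⟩))
  have hcgω := ((isBoundedBilinearMap_apply (𝕜 := ℝ) (E := E) (F := F)).continuous.tendsto
    (g t (x t), ω t - ω s)).comp (hcg.prodMk_nhds hcω)
  refine ⟨le_of_tendsto ((hx s).sub (hx' t)).norm (hev.mono fun n hn => hn.1), ?_⟩
  refine le_of_tendsto ((((hx s).sub (hx' t)).sub (hS.tendsto_integral hsT htT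
    (fun n => hτT n _) (fun n => hτT n _) ((hτ1 s hsT).mono_left hUle)
    ((hτ2 t htT).mono_left hUle) (hx' t))).sub hcgω).norm
    (hev.mono fun n hn => hn.2)

end YoungSolution

lemma IsSmallControl.continuousOn_of_norm_sub_le {F : Type*} [NormedAddCommGroup F]
    {T K γ η : ℝ} {W : ℝ → ℝ → ℝ} (hW : IsSmallControl T W) {x : ℝ → F}
    (hγ : 0 < γ) (hK : 0 ≤ K) (hη : 0 < η)
    (hx : ∀ s t, 0 ≤ s → s ≤ t → t ≤ T → t - s ≤ η → ‖x s - x t‖ ≤ K * W s t ^ γ) :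
    ContinuousOn x (Set.Icc 0 T) := by
  rw [Metric.continuousOn_iff]
  intro t ht e he
  obtain ⟨ε, hε0, -, hε⟩ := exists_pos_mul_rpow_le hK (half_pos he) hγ
  obtain ⟨η', hη', hsm⟩ := hW.small ε hε0
  have key : ∀ s t, 0 ≤ s → s ≤ t → t ≤ T → t - s < min η η' → dist (x s) (x t) < e := by
    intro s t hs hst ht h
    have h1 := hx s t hs hst ht (h.le.trans (min_le_left _ _))
    have h2 := hsm s t hs hst ht (h.le.trans (min_le_right _ _))
    have h3 := Real.rpow_le_rpow (hW.nonneg s t hs hst ht) h2 hγ.le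
    have h4 := mul_le_mul_of_nonneg_left h3 hK
    rw [dist_eq_norm]
    linarith
  refine ⟨min η η', lt_min hη hη', fun s hs hd => ?_⟩
  rw [Real.dist_eq] at hd
  rcases le_total s t with h | h
  · exact key s t hs.1 h ht.2 (by rwa [abs_sub_comm, abs_of_nonneg (sub_nonneg.2 h)] at hd)
  · rw [dist_comm]
    exact key t s ht.1 h hs.2 (by rwa [abs_of_nonneg (sub_nonneg.2 h)] at hd)

section YoungExistence

variable {E F : Type*} [NormedAddCommGroup E] [NormedSpace ℝ E]
  [NormedAddCommGroup F] [NormedSpace ℝ F]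
  {T a L G₀ β ρ γ σ : ℝ} {W : ℝ → ℝ → ℝ} {f : ℝ → F → F} {g : ℝ → F → (E →L[ℝ] F)}
  {ω : ℝ → E}

lemma IsYoungSystem.f_comp_intervalIntegrable (hS : IsYoungSystem T a L G₀ β ρ W f g ω)
    {x : ℝ → F} (hx : ContinuousOn x (Set.Icc 0 T)) {s t : ℝ} (hs : s ∈ Set.Icc 0 T)
    (ht : t ∈ Set.Icc 0 T) : IntervalIntegrable (fun r => f r (x r)) MeasureTheory.volume s t := by
  refine ContinuousOn.intervalIntegrable ?_
  have hsub := Set.uIcc_subset_Icc hs ht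
  exact hS.f_cont.comp (continuousOn_id.prodMk (hx.mono hsub))
    fun r hr => ⟨hsub hr, Set.mem_univ _⟩

lemma IsYoungSystem.norm_integral_sub_le (hS : IsYoungSystem T a L G₀ β ρ W f g ω)
    {x : ℝ → F} (hx : ContinuousOn x (Set.Icc 0 T)) {N M D s t : ℝ} (hM : 0 ≤ M)
    (hlip : ∀ t ∈ Set.Icc (0 : ℝ) T, ∀ x y, ‖x‖ ≤ N → ‖y‖ ≤ N → ‖f t x - f t y‖ ≤ M * ‖x - y‖)
    (hN : ∀ t ∈ Set.Icc 0 T, ‖x t‖ ≤ N) (hs : 0 ≤ s) (hst : s ≤ t) (ht : t ≤ T)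
    (hD : ∀ r ∈ Set.Icc s t, ‖x r - x t‖ ≤ D) :
    ‖(∫ r in s..t, f r (x r)) - ∫ r in s..t, f r (x t)‖ ≤ M * D * (t - s) := by
  have hsT : s ∈ Set.Icc 0 T := ⟨hs, hst.trans ht⟩
  have htT : t ∈ Set.Icc 0 T := ⟨hs.trans hst, ht⟩
  rw [← intervalIntegral.integral_sub (hS.f_comp_intervalIntegrable hx hsT htT)
    (hS.f_intervalIntegrable _ hsT htT), ← abs_of_nonneg (sub_nonneg.2 hst)]
  refine intervalIntegral.norm_integral_le_of_norm_le_const fun r hr => ?_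
  rw [Set.uIoc_of_le hst] at hr
  have hrT : r ∈ Set.Icc 0 T := ⟨hs.trans hr.1.le, hr.2.trans ht⟩
  exact (hlip r hrT _ _ (hN r hrT) (hN t htT)).trans
    (mul_le_mul_of_nonneg_left (hD r ⟨hr.1.le, hr.2⟩) hM)

lemma IsYoungSystem.exists_solution [ProperSpace F] (hS : IsYoungSystem T a L G₀ β ρ W f g ω)
    {q : ℝ} (hσ : 0 < σ) (hσβ : σ ≤ β) (hσγ : σ ≤ 1 / q) (hγρ : 1 / q < ρ) (hρ1 : ρ ≤ 1)
    (hθ : 1 < σ + ρ) (hT : 0 < T) (ξ : F) :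
    ∃ x : ℝ → F, ContinuousOn x (Set.Icc 0 T) ∧ FinitePVar q x 0 T ∧ x T = ξ ∧
      ∀ t ∈ Set.Icc (0 : ℝ) T,
        x t = ξ + (∫ s in t..T, f s (x s)) + youngIntegral (fun s => g s (x s)) ω t T := by
  obtain ⟨x, N, C, η, hN, hC, hη, hxT, hW1, hbd, hloc⟩ :=
    hS.exists_local_solution hσ hσβ hσγ hγρ hρ1 hθ hT ξ
  have hγ : 0 < 1 / q := by linarith
  have hq : 0 < q := one_div_pos.1 hγ
  have hL := hS.L_nonneg
  have hxc : ContinuousOn x (Set.Icc 0 T) := hS.control.continuousOn_of_norm_sub_le hγ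
    (by linarith : 0 ≤ 1 + N) hη fun s t hs hst ht h => (hloc s t hs hst ht h).1
  have h0T : (0 : ℝ) ∈ Set.Icc 0 T := ⟨le_rfl, hT.le⟩
  have hTT : T ∈ Set.Icc 0 T := ⟨hT.le, le_rfl⟩
  refine ⟨x, hxc, ?_, hxT, ?_⟩
  · refine hS.control.finitePVar hq (K := (1 + N) + 2 * N / η ^ (1 / q)) (by positivity) ?_
    intro s t hs hst ht
    have hw := Real.rpow_nonneg (hS.control.nonneg s t hs hst ht) (1 / q)
    rw [add_mul]
    rcases le_or_gt (t - s) η with h | h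
    · rw [norm_sub_rev]
      have := (hloc s t hs hst ht h).1
      have : 0 ≤ 2 * N / η ^ (1 / q) * W s t ^ (1 / q) := by positivity
      linarith
    · have h1 : η ^ (1 / q) ≤ W s t ^ (1 / q) :=
        Real.rpow_le_rpow hη.le (h.le.trans (hS.sub_le s t hs hst ht)) hγ.le
      have h2 : 0 < η ^ (1 / q) := Real.rpow_pos_of_pos hη _
      have h3 : 2 * N ≤ 2 * N / η ^ (1 / q) * W s t ^ (1 / q) := by
        rw [div_mul_eq_mul_div, le_div_iff₀ h2]
        gcongr
      have h4 := norm_sub_le (x t) (x s)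
      have h5 := hbd t ⟨hs.trans hst, ht⟩
      have h6 := hbd s ⟨hs, hst.trans ht⟩
      have : 0 ≤ (1 + N) * W s t ^ (1 / q) := by positivity
      linarith
  obtain ⟨M, hM, hlip⟩ := hS.f_lip N hN
  set I : ℝ → F := fun t => -x t - ∫ r in (0 : ℝ)..t, f r (x r) with hI
  set C' := C + M * (1 + N) + (1 + L * (1 + N)) with hC'
  have hIsub : ∀ s t, s ∈ Set.Icc 0 T → t ∈ Set.Icc 0 T →
      I t - I s = x s - x t - ∫ r in s..t, f r (x r) := by
    intro s t hs ht
    rw [← intervalIntegral.integral_interval_sub_left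
      (hS.f_comp_intervalIntegrable hxc h0T ht) (hS.f_comp_intervalIntegrable hxc h0T hs)]
    simp only [hI]
    abel
  intro t ht
  have hYI : IsYoungIntegral (fun s => g s (x s)) ω t T (I T - I t) := by
    refine hS.control.isYoungIntegral (θ := σ + ρ) (C := C') hθ (by positivity) hη ?_ ?_
      ht.1 ht.2 le_rfl
    · intro s t hs hst ht hle
      have hw0 := hS.control.nonneg s t hs hst ht
      have hw1 := hW1 s t hs hst ht hle
      have h1 := (hloc s t hs hst ht hle).2
      have h2 := hS.norm_integral_sub_le hxc hM hlip hbd hs hst ht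
        (D := (1 + N) * W s t ^ (1 / q)) fun r hr =>
          ((hloc r t (hs.trans hr.1) hr.2 ht (by linarith [hr.1])).1).trans
            (mul_le_mul_of_nonneg_left (Real.rpow_le_rpow
              (hS.control.nonneg r t (hs.trans hr.1) hr.2 ht)
              (hS.control.mono hs hr.1 hr.2 le_rfl ht) hγ.le) (by linarith))
      have h3 : M * ((1 + N) * W s t ^ (1 / q)) * (t - s) ≤ M * (1 + N) * W s t ^ (σ + ρ) := by
        calc _ ≤ M * ((1 + N) * W s t ^ (1 / q)) * W s t :=
              mul_le_mul_of_nonneg_left (hS.sub_le s t hs hst ht) (by positivity)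
          _ = M * (1 + N) * W s t ^ (1 / q + 1) := by
              rw [Real.rpow_add' hw0 (by linarith), Real.rpow_one]; ring
          _ ≤ _ := mul_le_mul_of_nonneg_left
              (rpow_le_rpow_of_le_one hw0 hw1 (by linarith) (by linarith)) (by positivity)
      rw [hIsub s t ⟨hs, hst.trans ht⟩ ⟨hs.trans hst, ht⟩]
      calc _ = ‖(x s - x t - (∫ r in s..t, f r (x t)) - g t (x t) (ω t - ω s)) -
            ((∫ r in s..t, f r (x r)) - ∫ r in s..t, f r (x t))‖ := by congr 1; abel
        _ ≤ C * W s t ^ (σ + ρ) + M * (1 + N) * W s t ^ (σ + ρ) :=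
            (norm_sub_le _ _).trans (add_le_add h1 (h2.trans h3))
        _ ≤ _ := by
            rw [hC', ← add_mul]
            refine mul_le_mul_of_nonneg_right ?_ (Real.rpow_nonneg hw0 _)
            have : 0 ≤ 1 + L * (1 + N) := by positivity
            linarith
    · intro s r t hs hsr hrt ht hle
      have hst := hsr.trans hrt
      have hw0 := hS.control.nonneg s t hs hst ht
      have hw1 := hW1 s t hs hst ht hle
      have hr0 := hS.control.nonneg r t (hs.trans hsr) hrt ht
      have hrw := hS.control.mono hs hsr hrt le_rfl ht
      have h1 := hS.norm_g_sub_le hσβ hσγ (hs.trans hsr) hrt ht (hrw.trans hw1) hσ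
        (by linarith : 0 ≤ 1 + N) (x := x t) (y := x r) (by
          rw [norm_sub_rev]
          exact (hloc r t (hs.trans hsr) hrt ht (by linarith)).1)
      calc _ ≤ ‖g t (x t) - g r (x r)‖ * ‖ω t - ω s‖ := ContinuousLinearMap.le_opNorm _ _
        _ ≤ ((1 + L * (1 + N)) * W s t ^ σ) * W s t ^ ρ := by
            refine mul_le_mul (h1.trans (mul_le_mul_of_nonneg_left
              (Real.rpow_le_rpow hr0 hrw hσ.le) (by positivity))) (hS.ω_le s t hs hst ht)
              (norm_nonneg _) (by positivity)
        _ = (1 + L * (1 + N)) * W s t ^ (σ + ρ) := by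
            rw [mul_assoc, ← Real.rpow_add' hw0 (by linarith)]
        _ ≤ _ := by
            refine mul_le_mul_of_nonneg_right ?_ (Real.rpow_nonneg hw0 _)
            have : 0 ≤ M * (1 + N) := by positivity
            linarith
  rw [hYI.youngIntegral_eq ht.2, hIsub t T ht hTT, hxT]
  abel

end YoungExistence

section YoungUniqueness

variable {E F : Type*} [NormedAddCommGroup E] [NormedSpace ℝ E]
  [NormedAddCommGroup F] [NormedSpace ℝ F]
  {T a L G₀ β ρ γ σ δ N M : ℝ} {W : ℝ → ℝ → ℝ} {f : ℝ → F → F} {g : ℝ → F → (E →L[ℝ] F)}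
  {ω : ℝ → E} {Dg : ℝ → F → (F →L[ℝ] E →L[ℝ] F)}

lemma norm_sub_sub_sub_le_of_hasFDerivAt {H : Type*} [NormedAddCommGroup H] [NormedSpace ℝ H]
    {g₁ g₂ : F → H} {D₁ D₂ : F → (F →L[ℝ] H)} {L B : ℝ} (hg₁ : ∀ p, HasFDerivAt g₁ (D₁ p) p)
    (hg₂ : ∀ p, HasFDerivAt g₂ (D₂ p) p) (hL : ∀ p, ‖D₁ p‖ ≤ L) (x₁ y₁ x₂ y₂ : F)
    (hB : ∀ c ∈ Set.Icc (0 : ℝ) 1,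
      ‖D₁ (y₁ + c • (x₁ - y₁)) - D₂ (y₂ + c • (x₂ - y₂))‖ ≤ B) :
    ‖(g₁ x₁ - g₁ y₁) - (g₂ x₂ - g₂ y₂)‖ ≤ L * ‖(x₁ - y₁) - (x₂ - y₂)‖ + B * ‖x₂ - y₂‖ := by
  have hline : ∀ (y v : F) (c : ℝ), HasDerivAt (fun c : ℝ => y + c • v) v c := fun y v c => by
    simpa using ((hasDerivAt_id c).smul_const v).const_add y
  have h := norm_image_sub_le_of_norm_deriv_le_segment_01'
    (f := fun c : ℝ => g₁ (y₁ + c • (x₁ - y₁)) - g₂ (y₂ + c • (x₂ - y₂)))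
    (f' := fun c => D₁ (y₁ + c • (x₁ - y₁)) (x₁ - y₁) - D₂ (y₂ + c • (x₂ - y₂)) (x₂ - y₂))
    (C := L * ‖(x₁ - y₁) - (x₂ - y₂)‖ + B * ‖x₂ - y₂‖)
    (fun c _ => (((hg₁ _).comp_hasDerivAt c (hline y₁ _ c)).sub
      ((hg₂ _).comp_hasDerivAt c (hline y₂ _ c))).hasDerivWithinAt)
    (fun c hc => by
      have hdec : D₁ (y₁ + c • (x₁ - y₁)) (x₁ - y₁) - D₂ (y₂ + c • (x₂ - y₂)) (x₂ - y₂) =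
          D₁ (y₁ + c • (x₁ - y₁)) ((x₁ - y₁) - (x₂ - y₂)) +
          (D₁ (y₁ + c • (x₁ - y₁)) - D₂ (y₂ + c • (x₂ - y₂))) (x₂ - y₂) := by
        rw [map_sub _ (x₁ - y₁) (x₂ - y₂), sub_apply]
        abel
      rw [hdec]
      exact (norm_add_le _ _).trans (add_le_add (ContinuousLinearMap.le_of_opNorm_le _ (hL _) _)
        (ContinuousLinearMap.le_of_opNorm_le _ (hB c ⟨hc.1, hc.2.le⟩) _)))
  simp only [one_smul, zero_smul, add_zero, add_sub_cancel] at h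
  convert h using 2
  abel

lemma norm_add_smul_sub_le {x y : F} {r c : ℝ} (hx : ‖x‖ ≤ r) (hy : ‖y‖ ≤ r)
    (hc : c ∈ Set.Icc (0 : ℝ) 1) : ‖y + c • (x - y)‖ ≤ r := by
  have h := (convex_closedBall (0 : F) r) (mem_closedBall_zero_iff.2 hy)
    (mem_closedBall_zero_iff.2 hx) (sub_nonneg.2 hc.2) hc.1 (by ring)
  rw [mem_closedBall_zero_iff] at h
  rwa [show y + c • (x - y) = (1 - c) • y + c • x by module]

lemma IsYoungSystem.norm_second_difference_le (hS : IsYoungSystem T a L G₀ β ρ W f g ω)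
    (hDg : ∀ t ∈ Set.Icc (0 : ℝ) T, ∀ x, HasFDerivAt (g t) (Dg t x) x)
    (hDgx : ∀ t ∈ Set.Icc (0 : ℝ) T, ∀ x y, ‖x‖ ≤ N → ‖y‖ ≤ N →
      ‖Dg t x - Dg t y‖ ≤ M * ‖x - y‖ ^ δ)
    (hDgt : ∀ s t x, 0 ≤ s → s ≤ t → t ≤ T → ‖Dg t x - Dg s x‖ ≤ W s t ^ β)
    (hM : 0 ≤ M) (hδ : 0 ≤ δ) {s t r : ℝ} (hs : 0 ≤ s) (hst : s ≤ t) (ht : t ≤ T)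
    {x₁ y₁ x₂ y₂ : F} (hx₁ : ‖x₁‖ ≤ N) (hy₁ : ‖y₁‖ ≤ N) (hx₂ : ‖x₂‖ ≤ N) (hy₂ : ‖y₂‖ ≤ N)
    (hx : ‖x₁ - x₂‖ ≤ r) (hy : ‖y₁ - y₂‖ ≤ r) :
    ‖(g t x₁ - g t y₁) - (g s x₂ - g s y₂)‖ ≤
      L * ‖(x₁ - y₁) - (x₂ - y₂)‖ + (M * r ^ δ + W s t ^ β) * ‖x₂ - y₂‖ := by
  have htT : t ∈ Set.Icc 0 T := ⟨hs.trans hst, ht⟩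
  refine norm_sub_sub_sub_le_of_hasFDerivAt (hDg t htT) (hDg s ⟨hs, hst.trans ht⟩)
    (fun p => (hDg t htT p).le_of_lip' hS.L_nonneg (.of_forall fun x => hS.g_lip t htT x p))
    _ _ _ _ fun c hc => ?_
  have h1 := hDgx t htT (y₁ + c • (x₁ - y₁)) (y₂ + c • (x₂ - y₂))
    (norm_add_smul_sub_le hx₁ hy₁ hc) (norm_add_smul_sub_le hx₂ hy₂ hc)
  have h2 : ‖(y₁ + c • (x₁ - y₁)) - (y₂ + c • (x₂ - y₂))‖ ≤ r := by
    rw [show (y₁ + c • (x₁ - y₁)) - (y₂ + c • (x₂ - y₂)) =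
      (y₁ - y₂) + c • ((x₁ - x₂) - (y₁ - y₂)) by module]
    exact norm_add_smul_sub_le hx hy hc
  refine (norm_sub_le_norm_sub_add_norm_sub _ (Dg t (y₂ + c • (x₂ - y₂))) _).trans ?_
  exact add_le_add (h1.trans (mul_le_mul_of_nonneg_left
    (Real.rpow_le_rpow (norm_nonneg _) h2 hδ) hM)) (hDgt s t _ hs hst ht)

/-- First-order expansion of a solution that is Hölder with respect to the control. -/
lemma IsYoungSystem.exists_expansion [ProperSpace F] (hS : IsYoungSystem T a L G₀ β ρ W f g ω)
    (hσ : 0 < σ) (hσβ : σ ≤ β) (hσγ : σ ≤ γ) (hρ : 0 < ρ) (hθ : 1 < σ + ρ) (hT : 0 ≤ T) {ξ : F}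
    {x : ℝ → F} (hxc : ContinuousOn x (Set.Icc 0 T))
    (hx : ∀ s t, 0 ≤ s → s ≤ t → t ≤ T → ‖x t - x s‖ ≤ W s t ^ γ)
    (hsol : ∀ t ∈ Set.Icc (0 : ℝ) T,
      x t = ξ + (∫ s in t..T, f s (x s)) + youngIntegral (fun s => g s (x s)) ω t T) :
    ∃ C, 0 ≤ C ∧ ∀ s t, 0 ≤ s → s ≤ t → t ≤ T →
      ‖x s - x t - (∫ r in s..t, f r (x r)) - g t (x t) (ω t - ω s)‖ ≤ C * W s t ^ (σ + ρ) := by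
  have hL := hS.L_nonneg
  set B := W 0 T + 1
  have hB : 0 < B := by
    have := hS.control.nonneg 0 T le_rfl hT le_rfl
    linarith
  set C := B ^ (β - σ) + L * B ^ (γ - σ)
  have hC : 0 ≤ C := by positivity
  have hpow : ∀ κ s t, σ ≤ κ → 0 ≤ s → s ≤ t → t ≤ T → W s t ^ κ ≤ B ^ (κ - σ) * W s t ^ σ := by
    intro κ s t hκ hs hst ht
    have h0 := hS.control.nonneg s t hs hst ht
    have h1 := hS.control.mono le_rfl hs hst ht le_rfl
    calc W s t ^ κ = W s t ^ (κ - σ) * W s t ^ σ := by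
          rw [← Real.rpow_add' h0 (by linarith), sub_add_cancel]
      _ ≤ _ := mul_le_mul_of_nonneg_right
          (Real.rpow_le_rpow h0 (by linarith) (by linarith)) (Real.rpow_nonneg h0 _)
  have hG : ∀ s t, 0 ≤ s → s ≤ t → t ≤ T →
      ‖g t (x t) - g s (x s)‖ ≤ C * W s t ^ σ := by
    intro s t hs hst ht
    calc _ = ‖(g t (x t) - g t (x s)) + (g t (x s) - g s (x s))‖ := by congr 1; abel
      _ ≤ L * W s t ^ γ + W s t ^ β := (norm_add_le _ _).trans (add_le_add
          ((hS.g_lip t ⟨hs.trans hst, ht⟩ _ _).trans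
            (mul_le_mul_of_nonneg_left (hx s t hs hst ht) hL)) (hS.g_time s t _ hs hst ht))
      _ ≤ L * (B ^ (γ - σ) * W s t ^ σ) + B ^ (β - σ) * W s t ^ σ :=
          add_le_add (mul_le_mul_of_nonneg_left (hpow γ s t hσγ hs hst ht) hL)
            (hpow β s t hσβ hs hst ht)
      _ = _ := by ring
  have hGω : ∀ r t u v s t', 0 ≤ s → s ≤ r → r ≤ t → t ≤ t' → t' ≤ T → s ≤ u → u ≤ v → v ≤ t' →
      ‖(g t (x t) - g r (x r)) (ω v - ω u)‖ ≤ C * W s t' ^ (σ + ρ) := by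
    intro r t u v s t' hs hsr hrt htt' ht' hsu huv hv
    have hst' := hsr.trans (hrt.trans htt')
    have h0 := hS.control.nonneg s t' hs hst' ht'
    calc _ ≤ ‖g t (x t) - g r (x r)‖ * ‖ω v - ω u‖ := ContinuousLinearMap.le_opNorm _ _
      _ ≤ (C * W r t ^ σ) * W u v ^ ρ := by
          have h1 := hS.control.nonneg r t (hs.trans hsr) hrt (htt'.trans ht')
          exact mul_le_mul (hG r t (hs.trans hsr) hrt (htt'.trans ht'))
            (hS.ω_le u v (hs.trans hsu) huv (hv.trans ht')) (norm_nonneg _) (by positivity)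
      _ ≤ (C * W s t' ^ σ) * W s t' ^ ρ := by
          have h1 := hS.control.nonneg r t (hs.trans hsr) hrt (htt'.trans ht')
          have h2 := hS.control.nonneg u v (hs.trans hsu) huv (hv.trans ht')
          have h3 := hS.control.mono hs hsr hrt htt' ht'
          have h4 := hS.control.mono hs hsu huv hv ht'
          gcongr
      _ = _ := by rw [mul_assoc, ← Real.rpow_add' h0 (by linarith)]
  obtain ⟨I, hI⟩ := hS.control.exists_sewing hT hθ hC
    (fun s t => g t (x t) (ω t - ω s)) (fun s r t hs hsr hrt ht => by
      have hdec : g t (x t) (ω t - ω s) - g r (x r) (ω r - ω s) - g t (x t) (ω t - ω r) =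
          (g t (x t) - g r (x r)) (ω r - ω s) := by
        rw [show ω t - ω s = (ω t - ω r) + (ω r - ω s) by abel, map_add, sub_apply]
        abel
      rw [hdec]
      exact hGω r t s r s t hs hsr hrt le_rfl ht le_rfl hsr hrt)
  have hA := (sewingConst_spec hθ).1
  have hTT : T ∈ Set.Icc 0 T := ⟨hT, le_rfl⟩
  have hYI : ∀ t ∈ Set.Icc (0 : ℝ) T,
      youngIntegral (fun s => g s (x s)) ω t T = I T - I t := by
    intro t ht
    refine (hS.control.isYoungIntegral (θ := σ + ρ) (C := sewingConst (σ + ρ) * C + C) hθ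
      (by positivity) one_pos ?_ ?_ ht.1 ht.2 le_rfl).youngIntegral_eq ht.2
    · intro s t hs hst ht _
      have h0 := Real.rpow_nonneg (hS.control.nonneg s t hs hst ht) (σ + ρ)
      refine (hI s t hs hst ht).trans (mul_le_mul_of_nonneg_right ?_ h0)
      linarith
    · intro s r t hs hsr hrt ht _
      have h0 := Real.rpow_nonneg (hS.control.nonneg s t hs (hsr.trans hrt) ht) (σ + ρ)
      refine (hGω r t s t s t hs hsr hrt le_rfl ht le_rfl (hsr.trans hrt) le_rfl).trans
        (mul_le_mul_of_nonneg_right ?_ h0)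
      have : 0 ≤ sewingConst (σ + ρ) * C := by positivity
      linarith
  refine ⟨sewingConst (σ + ρ) * C, by positivity, fun s t hs hst ht => ?_⟩
  have hsT : s ∈ Set.Icc 0 T := ⟨hs, hst.trans ht⟩
  have htT : t ∈ Set.Icc 0 T := ⟨hs.trans hst, ht⟩
  have heq : x s - x t = (∫ r in s..t, f r (x r)) + (I t - I s) := by
    rw [hsol s hsT, hsol t htT, hYI s hsT, hYI t htT,
      ← intervalIntegral.integral_add_adjacent_intervals
        (hS.f_comp_intervalIntegrable hxc hsT htT) (hS.f_comp_intervalIntegrable hxc htT hTT)]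
    abel
  rw [heq, add_sub_cancel_left]
  exact hI s t hs hst ht

end YoungUniqueness

section YoungContraction

variable {E F : Type*} [NormedAddCommGroup E] [NormedSpace ℝ E]
  [NormedAddCommGroup F] [NormedSpace ℝ F]
  {T a L G₀ β ρ γ σ δ N M : ℝ} {W : ℝ → ℝ → ℝ} {f : ℝ → F → F} {g : ℝ → F → (E →L[ℝ] F)}
  {ω : ℝ → E} {Dg : ℝ → F → (F →L[ℝ] E →L[ℝ] F)}

lemma IsYoungSystem.norm_sub_sub_sub_le_half (hS : IsYoungSystem T a L G₀ β ρ W f g ω)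
    (hDg : ∀ t ∈ Set.Icc (0 : ℝ) T, ∀ x, HasFDerivAt (g t) (Dg t x) x)
    (hDgx : ∀ t ∈ Set.Icc (0 : ℝ) T, ∀ x y, ‖x‖ ≤ N → ‖y‖ ≤ N →
      ‖Dg t x - Dg t y‖ ≤ M * ‖x - y‖ ^ δ)
    (hDgt : ∀ s t x, 0 ≤ s → s ≤ t → t ≤ T → ‖Dg t x - Dg s x‖ ≤ W s t ^ β)
    (hM : 0 ≤ M) (hδ : 0 < δ) (hδ1 : δ ≤ 1) (hσ : 0 < σ) (hσβ : σ ≤ β) (hσγ : σ ≤ γ * δ)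
    (hγρ : γ < ρ) (hρ1 : ρ ≤ 1) (hθ : 1 < σ + ρ) {Mf : ℝ} (hMf : 0 ≤ Mf)
    (hflip : ∀ t ∈ Set.Icc (0 : ℝ) T, ∀ x y, ‖x‖ ≤ N → ‖y‖ ≤ N →
      ‖f t x - f t y‖ ≤ Mf * ‖x - y‖)
    {x y : ℝ → F} (hxc : ContinuousOn x (Set.Icc 0 T)) (hyc : ContinuousOn y (Set.Icc 0 T))
    (hxN : ∀ t ∈ Set.Icc 0 T, ‖x t‖ ≤ N) (hyN : ∀ t ∈ Set.Icc 0 T, ‖y t‖ ≤ N)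
    (hx : ∀ s t, 0 ≤ s → s ≤ t → t ≤ T → ‖x t - x s‖ ≤ W s t ^ γ)
    (hy : ∀ s t, 0 ≤ s → s ≤ t → t ≤ T → ‖y t - y s‖ ≤ W s t ^ γ) {C C' : ℝ} (hC : 0 ≤ C)
    (hC' : 0 ≤ C')
    (hxe : ∀ s t, 0 ≤ s → s ≤ t → t ≤ T →
      ‖x s - x t - (∫ r in s..t, f r (x r)) - g t (x t) (ω t - ω s)‖ ≤ C * W s t ^ (σ + ρ))
    (hye : ∀ s t, 0 ≤ s → s ≤ t → t ≤ T →
      ‖y s - y t - (∫ r in s..t, f r (y r)) - g t (y t) (ω t - ω s)‖ ≤ C' * W s t ^ (σ + ρ))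
    {ε : ℝ} (hε1 : ε ≤ 1)
    (hε : (sewingConst (σ + ρ) * (L + M + 1) + Mf + L) * ε ^ (ρ - γ) ≤ 1 / 2)
    {u v D : ℝ} (hu : 0 ≤ u) (hv : v ≤ T) (hW : W u v ≤ ε) (hxy : x v = y v) (hD0 : 0 ≤ D)
    (hD : ∀ s t, u ≤ s → s ≤ t → t ≤ v → ‖(x s - y s) - (x t - y t)‖ ≤ D * W s t ^ γ) :
    ∀ s t, u ≤ s → s ≤ t → t ≤ v → ‖(x s - y s) - (x t - y t)‖ ≤ D / 2 * W s t ^ γ := by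
  have hL := hS.L_nonneg
  have hγδ : 0 < γ * δ := by linarith
  have hγ : 0 < γ := pos_of_mul_pos_left hγδ hδ.le
  have hγδγ : γ * δ ≤ γ := mul_le_of_le_one_right hγ.le hδ1
  have hA := (sewingConst_spec hθ).1
  have hw0 : ∀ s t, u ≤ s → s ≤ t → t ≤ v → 0 ≤ W s t := fun s t hs hst ht =>
    hS.control.nonneg s t (hu.trans hs) hst (ht.trans hv)
  have hwε : ∀ s t, u ≤ s → s ≤ t → t ≤ v → W s t ≤ ε := fun s t hs hst ht =>
    (hS.control.mono hu hs hst ht hv).trans hW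
  have hw1 : ∀ s t, u ≤ s → s ≤ t → t ≤ v → W s t ≤ 1 := fun s t hs hst ht =>
    (hwε s t hs hst ht).trans hε1
  have hmem : ∀ s, u ≤ s → s ≤ v → s ∈ Set.Icc 0 T := fun s h1 h2 => ⟨hu.trans h1, h2.trans hv⟩
  have hΔ : ∀ s, u ≤ s → s ≤ v → ‖x s - y s‖ ≤ D := by
    intro s hs hsv
    have h1 := hD s v hs hsv le_rfl
    rw [hxy, sub_self, sub_zero] at h1
    exact h1.trans (mul_le_of_le_one_right hD0
      (Real.rpow_le_one (hw0 s v hs hsv le_rfl) (hw1 s v hs hsv le_rfl) hγ.le))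
  have hΓ : ∀ s t, u ≤ s → s ≤ t → t ≤ v →
      ‖(g t (x t) - g t (y t)) - (g s (x s) - g s (y s))‖ ≤ D * (L + M + 1) * W s t ^ σ := by
    intro s t hs hst ht
    have h0 := hw0 s t hs hst ht
    have h1 := hw1 s t hs hst ht
    have hs0 := hu.trans hs
    have htT := ht.trans hv
    have hsT := hmem s hs (hst.trans ht)
    have ht' := hmem t (hs.trans hst) ht
    have h2 := hS.norm_second_difference_le hDg hDgx hDgt hM hδ.le hs0 hst htT (hxN t ht')
      (hyN t ht') (hxN s hsT) (hyN s hsT) (hx s t hs0 hst htT) (hy s t hs0 hst htT)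
    have h3 := hD s t hs hst ht
    rw [norm_sub_rev] at h3
    have e1 : W s t ^ γ ≤ W s t ^ σ := rpow_le_rpow_of_le_one h0 h1 hσ (by linarith)
    have e2 : (W s t ^ γ) ^ δ ≤ W s t ^ σ := by
      rw [← Real.rpow_mul h0]
      exact rpow_le_rpow_of_le_one h0 h1 hσ hσγ
    have e3 : W s t ^ β ≤ W s t ^ σ := rpow_le_rpow_of_le_one h0 h1 hσ hσβ
    have e4 := hΔ s hs (hst.trans ht)
    calc _ ≤ _ := h2
      _ ≤ L * (D * W s t ^ σ) + (M * W s t ^ σ + W s t ^ σ) * D := by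
          have : 0 ≤ W s t ^ σ := Real.rpow_nonneg h0 _
          have h5 : D * W s t ^ γ ≤ D * W s t ^ σ := mul_le_mul_of_nonneg_left e1 hD0
          refine add_le_add (mul_le_mul_of_nonneg_left (h3.trans h5) hL)
            (mul_le_mul (add_le_add (mul_le_mul_of_nonneg_left e2 hM) e3) e4 (norm_nonneg _)
              (by positivity))
      _ = _ := by ring
  set R : ℝ → ℝ → F := fun s t => (x s - y s) - (x t - y t) -
    ((∫ r in s..t, f r (x r)) - ∫ r in s..t, f r (y r)) -
    (g t (x t) - g t (y t)) (ω t - ω s) with hR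
  have hRb : ∀ s t, u ≤ s → s ≤ t → t ≤ v →
      ‖R s t‖ ≤ sewingConst (σ + ρ) * (D * (L + M + 1)) * W s t ^ (σ + ρ) := by
    intro s t hs hst ht
    refine hS.control.sewing_bound hθ (C' := C + C') (by positivity) (by positivity) hu hv R
      ?_ ?_ hs hst ht
    · intro s r t hs hsr hrt ht
      have hst := hsr.trans hrt
      have hsT := hmem s hs (hst.trans ht)
      have htT := hmem t (hs.trans hst) ht
      have hrT := hmem r (hs.trans hsr) (hrt.trans ht)
      have hdec : R s t - R s r - R r t =
          -(((g t (x t) - g t (y t)) - (g r (x r) - g r (y r))) (ω r - ω s)) := by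
        simp only [hR]
        rw [← intervalIntegral.integral_add_adjacent_intervals
            (hS.f_comp_intervalIntegrable hxc hsT hrT) (hS.f_comp_intervalIntegrable hxc hrT htT),
          ← intervalIntegral.integral_add_adjacent_intervals
            (hS.f_comp_intervalIntegrable hyc hsT hrT) (hS.f_comp_intervalIntegrable hyc hrT htT),
          show ω t - ω s = (ω t - ω r) + (ω r - ω s) by abel,
          map_add _ (ω t - ω r) (ω r - ω s), sub_apply _ (g r (x r) - g r (y r))]
        abel
      rw [hdec, norm_neg]
      have h0 := hw0 s t hs hst ht
      have h1 := hw0 r t (hs.trans hsr) hrt ht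
      have h2 := hw0 s r hs hsr (hrt.trans ht)
      have h3 := hS.control.mono hsT.1 hsr hrt le_rfl htT.2
      have h4 := hS.control.mono hsT.1 le_rfl hsr hrt htT.2
      calc _ ≤ _ := ContinuousLinearMap.le_opNorm _ _
        _ ≤ (D * (L + M + 1) * W r t ^ σ) * W s r ^ ρ :=
            mul_le_mul (hΓ r t (hs.trans hsr) hrt ht) (hS.ω_le s r hsT.1 hsr hrT.2)
              (norm_nonneg _) (by positivity)
        _ ≤ (D * (L + M + 1) * W s t ^ σ) * W s t ^ ρ := by
            have : 0 < ρ := by linarith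
            gcongr
        _ = _ := by rw [mul_assoc, ← Real.rpow_add' h0 (by linarith)]
    · intro s t hs hst ht
      have h1 := hxe s t (hu.trans hs) hst (ht.trans hv)
      have h2 := hye s t (hu.trans hs) hst (ht.trans hv)
      have heq : R s t = (x s - x t - (∫ r in s..t, f r (x r)) - g t (x t) (ω t - ω s)) -
          (y s - y t - (∫ r in s..t, f r (y r)) - g t (y t) (ω t - ω s)) := by
        simp only [hR, sub_apply]
        abel
      rw [heq, add_mul]
      exact (norm_sub_le _ _).trans (add_le_add h1 h2)
  intro s t hs hst ht
  have hsT := hmem s hs (hst.trans ht)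
  have htT := hmem t (hs.trans hst) ht
  have h0 := hw0 s t hs hst ht
  have h1 := hw1 s t hs hst ht
  have hint : ‖(∫ r in s..t, f r (x r)) - ∫ r in s..t, f r (y r)‖ ≤ Mf * D * W s t := by
    rw [← intervalIntegral.integral_sub (hS.f_comp_intervalIntegrable hxc hsT htT)
      (hS.f_comp_intervalIntegrable hyc hsT htT)]
    refine (intervalIntegral.norm_integral_le_of_norm_le_const (C := Mf * D) fun r hr => ?_).trans
      (mul_le_mul_of_nonneg_left ?_ (by positivity))
    · rw [Set.uIoc_of_le hst] at hr
      have hr' := hmem r (hs.trans hr.1.le) (hr.2.trans ht)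
      exact (hflip r hr' _ _ (hxN r hr') (hyN r hr')).trans
        (mul_le_mul_of_nonneg_left (hΔ r (hs.trans hr.1.le) (hr.2.trans ht)) hMf)
    · rw [abs_of_nonneg (sub_nonneg.2 hst)]
      exact hS.sub_le s t hsT.1 hst htT.2
  have hgt : ‖(g t (x t) - g t (y t)) (ω t - ω s)‖ ≤ L * D * W s t ^ ρ := by
    refine (ContinuousLinearMap.le_opNorm _ _).trans (mul_le_mul ?_
      (hS.ω_le s t hsT.1 hst htT.2) (norm_nonneg _) (by positivity))
    exact (hS.g_lip t htT _ _).trans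
      (mul_le_mul_of_nonneg_left (hΔ t (hs.trans hst) ht) hL)
  have e1 : W s t ≤ W s t ^ ρ := by
    simpa using rpow_le_rpow_of_le_one (κ' := 1) h0 h1 (by linarith : 0 < ρ) hρ1
  have e2 : W s t ^ (σ + ρ) ≤ W s t ^ ρ :=
    rpow_le_rpow_of_le_one h0 h1 (by linarith) (by linarith)
  have e3 : W s t ^ ρ ≤ ε ^ (ρ - γ) * W s t ^ γ := by
    rw [show ρ = (ρ - γ) + γ by ring, Real.rpow_add' h0 (by linarith), add_sub_cancel_right]
    have := hwε s t hs hst ht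
    gcongr
  calc ‖(x s - y s) - (x t - y t)‖ = ‖R s t +
        ((∫ r in s..t, f r (x r)) - ∫ r in s..t, f r (y r)) +
        (g t (x t) - g t (y t)) (ω t - ω s)‖ := by
        congr 1
        simp only [hR]
        abel
    _ ≤ sewingConst (σ + ρ) * (D * (L + M + 1)) * W s t ^ (σ + ρ) + Mf * D * W s t +
        L * D * W s t ^ ρ :=
        norm_add₃_le.trans (add_le_add (add_le_add (hRb s t hs hst ht) hint) hgt)
    _ ≤ sewingConst (σ + ρ) * (D * (L + M + 1)) * W s t ^ ρ + Mf * D * W s t ^ ρ +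
        L * D * W s t ^ ρ := by gcongr
    _ = D * ((sewingConst (σ + ρ) * (L + M + 1) + Mf + L) * W s t ^ ρ) := by ring
    _ ≤ D * ((sewingConst (σ + ρ) * (L + M + 1) + Mf + L) * (ε ^ (ρ - γ) * W s t ^ γ)) := by
        gcongr
    _ = D * ((sewingConst (σ + ρ) * (L + M + 1) + Mf + L) * ε ^ (ρ - γ)) * W s t ^ γ := by ring
    _ ≤ D * (1 / 2) * W s t ^ γ := by gcongr
    _ = _ := by ring

lemma IsYoungSystem.solution_unique [ProperSpace F] (hS : IsYoungSystem T a L G₀ β ρ W f g ω)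
    (hDg : ∀ t ∈ Set.Icc (0 : ℝ) T, ∀ x, HasFDerivAt (g t) (Dg t x) x)
    (hDgx : ∀ N, 0 ≤ N → ∃ M, 0 ≤ M ∧ ∀ t ∈ Set.Icc (0 : ℝ) T, ∀ x y, ‖x‖ ≤ N → ‖y‖ ≤ N →
      ‖Dg t x - Dg t y‖ ≤ M * ‖x - y‖ ^ δ)
    (hDgt : ∀ s t x, 0 ≤ s → s ≤ t → t ≤ T → ‖Dg t x - Dg s x‖ ≤ W s t ^ β)
    (hδ : 0 < δ) (hδ1 : δ ≤ 1) (hσ : 0 < σ) (hσβ : σ ≤ β) (hσγ : σ ≤ γ * δ)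
    (hγρ : γ < ρ) (hρ1 : ρ ≤ 1) (hθ : 1 < σ + ρ) (hT : 0 ≤ T) {ξ : F}
    {x y : ℝ → F} (hxc : ContinuousOn x (Set.Icc 0 T)) (hyc : ContinuousOn y (Set.Icc 0 T))
    (hx : ∀ s t, 0 ≤ s → s ≤ t → t ≤ T → ‖x t - x s‖ ≤ W s t ^ γ)
    (hy : ∀ s t, 0 ≤ s → s ≤ t → t ≤ T → ‖y t - y s‖ ≤ W s t ^ γ)
    (hxT : x T = ξ) (hyT : y T = ξ)
    (hxs : ∀ t ∈ Set.Icc (0 : ℝ) T,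
      x t = ξ + (∫ s in t..T, f s (x s)) + youngIntegral (fun s => g s (x s)) ω t T)
    (hys : ∀ t ∈ Set.Icc (0 : ℝ) T,
      y t = ξ + (∫ s in t..T, f s (y s)) + youngIntegral (fun s => g s (y s)) ω t T) :
    ∀ t ∈ Set.Icc (0 : ℝ) T, x t = y t := by
  have hL := hS.L_nonneg
  have hγδ : 0 < γ * δ := by linarith
  have hγ : 0 < γ := pos_of_mul_pos_left hγδ hδ.le
  have hσγ' : σ ≤ γ := hσγ.trans (mul_le_of_le_one_right hγ.le hδ1)
  have hA := (sewingConst_spec hθ).1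
  obtain ⟨Nx, hNx⟩ := isCompact_Icc.exists_bound_of_continuousOn hxc
  obtain ⟨Ny, hNy⟩ := isCompact_Icc.exists_bound_of_continuousOn hyc
  set N := max 0 (max Nx Ny)
  have hxN : ∀ t ∈ Set.Icc 0 T, ‖x t‖ ≤ N := fun t ht =>
    (hNx t ht).trans ((le_max_left _ _).trans (le_max_right _ _))
  have hyN : ∀ t ∈ Set.Icc 0 T, ‖y t‖ ≤ N := fun t ht =>
    (hNy t ht).trans ((le_max_right _ _).trans (le_max_right _ _))
  obtain ⟨M, hM, hDgx⟩ := hDgx N (le_max_left _ _)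
  obtain ⟨Mf, hMf, hflip⟩ := hS.f_lip N (le_max_left _ _)
  obtain ⟨C, hC, hxe⟩ := hS.exists_expansion hσ hσβ hσγ' (by linarith) hθ hT hxc hx hxs
  obtain ⟨C', hC', hye⟩ := hS.exists_expansion hσ hσβ hσγ' (by linarith) hθ hT hyc hy hys
  obtain ⟨ε, hε0, hε1, hε⟩ := exists_pos_mul_rpow_le
    (by positivity : 0 ≤ sewingConst (σ + ρ) * (L + M + 1) + Mf + L)
    (by norm_num : (0 : ℝ) < 1 / 2) (sub_pos.2 hγρ)
  obtain ⟨η, hη, hηε⟩ := hS.control.small ε hε0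
  have hblock : ∀ u v, 0 ≤ u → u ≤ v → v ≤ T → v - u ≤ η → x v = y v → x u = y u := by
    intro u v hu huv hv hle hxy
    have hiter : ∀ n : ℕ, ∀ s t, u ≤ s → s ≤ t → t ≤ v →
        ‖(x s - y s) - (x t - y t)‖ ≤ 2 * (1 / 2) ^ n * W s t ^ γ := by
      intro n
      induction n with
      | zero =>
        intro s t hs hst ht
        have h1 := hx s t (hu.trans hs) hst (ht.trans hv)
        have h2 := hy s t (hu.trans hs) hst (ht.trans hv)
        calc _ = ‖(y t - y s) - (x t - x s)‖ := by congr 1; abel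
          _ ≤ W s t ^ γ + W s t ^ γ := (norm_sub_le _ _).trans (add_le_add h2 h1)
          _ = _ := by ring
      | succ n ih =>
        have := hS.norm_sub_sub_sub_le_half hDg hDgx hDgt hM hδ hδ1 hσ hσβ hσγ hγρ hρ1 hθ hMf
          hflip hxc hyc hxN hyN hx hy hC hC' hxe hye hε1 hε hu hv (hηε u v hu huv hv hle) hxy
          (by positivity) ih
        intro s t hs hst ht
        refine (this s t hs hst ht).trans_eq ?_
        ring
    have hlim : Filter.Tendsto (fun n : ℕ => 2 * (1 / 2 : ℝ) ^ n * W u v ^ γ) Filter.atTop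
        (nhds 0) := by
      simpa using ((tendsto_pow_atTop_nhds_zero_of_lt_one (by norm_num : (0 : ℝ) ≤ 1 / 2)
        (by norm_num)).const_mul 2).mul_const (W u v ^ γ)
    have h := ge_of_tendsto' hlim fun n => hiter n u v le_rfl huv le_rfl
    rw [hxy, sub_self, sub_zero] at h
    exact sub_eq_zero.1 (norm_le_zero_iff.1 h)
  have hind : ∀ j : ℕ, ∀ t ∈ Set.Icc (0 : ℝ) T, T - t ≤ j * η → x t = y t := by
    intro j
    induction j with
    | zero =>
      intro t ht h
      obtain rfl : t = T := le_antisymm ht.2 (by simpa using h)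
      rw [hxT, hyT]
    | succ j ih =>
      intro t ht h
      push_cast at h
      have h1 : t ≤ min T (t + η) := le_min ht.2 (by linarith)
      refine hblock t (min T (t + η)) ht.1 h1 (min_le_left _ _)
        (by linarith [min_le_right T (t + η)])
        (ih _ ⟨ht.1.trans h1, min_le_left _ _⟩ ?_)
      rcases min_choice T (t + η) with h2 | h2
      · rw [h2, sub_self]
        positivity
      · rw [h2]
        linarith
  intro t ht
  refine hind ⌈T / η⌉₊ t ht ?_
  have h1 := Nat.le_ceil (T / η)
  rw [div_le_iff₀ hη] at h1
  linarith [ht.1]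

end YoungContraction

lemma IsControlOn.isSmallControl {T : ℝ} {w : ℝ → ℝ → ℝ} (hw : IsControlOn 0 T w) :
    IsSmallControl T w where
  nonneg s t hs hst ht := hw.2.2.2 s t hs hst ht
  superadd s u t hs hsu hut ht := hw.2.2.1 s u t hs hsu hut ht
  small ε hε := by
    obtain ⟨hc, h0, -, -⟩ := hw
    set S : Set (ℝ × ℝ) := {pr | 0 ≤ pr.1 ∧ pr.1 ≤ pr.2 ∧ pr.2 ≤ T} with hS
    have hcl : IsClosed S :=
      (isClosed_le continuous_const continuous_fst).inter
        ((isClosed_le continuous_fst continuous_snd).inter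
          (isClosed_le continuous_snd continuous_const))
    have hSc : IsCompact S := IsCompact.of_isClosed_subset
      (isCompact_Icc.prod isCompact_Icc : IsCompact (Set.Icc 0 T ×ˢ Set.Icc 0 T)) hcl fun pr hpr =>
        ⟨⟨hpr.1, hpr.2.1.trans hpr.2.2⟩, ⟨hpr.1.trans hpr.2.1, hpr.2.2⟩⟩
    obtain ⟨η, hη, hu⟩ :=
      Metric.uniformContinuousOn_iff.1 (hSc.uniformContinuousOn_of_continuous hc) ε hε
    refine ⟨η / 2, half_pos hη, fun s t hs hst ht hstη => ?_⟩
    have h1 := hu (s, t) ⟨hs, hst, ht⟩ (s, s) ⟨hs, le_rfl, hst.trans ht⟩ (by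
      rw [Prod.dist_eq]
      simp only [dist_self, Real.dist_eq, abs_of_nonneg (sub_nonneg.2 hst)]
      exact max_lt hη (by linarith))
    simp only [h0 s hs (hst.trans ht), Real.dist_eq, sub_zero] at h1
    exact (le_abs_self _).trans h1.le

lemma isControlOn_sub (T : ℝ) : IsControlOn 0 T fun s t => t - s :=
  ⟨by fun_prop, fun t _ _ => sub_self t, fun s t u _ _ _ _ => by linarith,
    fun s t _ hst _ => sub_nonneg.2 hst⟩

lemma isControlOn_integral {T : ℝ} {φ : ℝ → ℝ} (hT : 0 ≤ T) (h0 : ∀ t, 0 ≤ φ t)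
    (hφ : IntervalIntegrable φ MeasureTheory.volume 0 T) :
    IsControlOn 0 T fun s t => ∫ r in s..t, φ r := by
  have hsub : ∀ s t, 0 ≤ s → s ≤ t → t ≤ T →
      IntervalIntegrable φ MeasureTheory.volume s t := fun s t hs hst ht =>
    hφ.mono_set (by
      rw [Set.uIcc_of_le hst, Set.uIcc_of_le hT]
      exact Set.Icc_subset_Icc hs ht)
  have hadd : ∀ s t u, 0 ≤ s → s ≤ t → t ≤ u → u ≤ T →
      (∫ r in s..t, φ r) + (∫ r in t..u, φ r) = ∫ r in s..u, φ r := fun s t u h1 h2 h3 h4 =>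
    intervalIntegral.integral_add_adjacent_intervals (hsub s t h1 h2 (h3.trans h4))
      (hsub t u (h1.trans h2) h3 h4)
  have hprim : ContinuousOn (fun t => ∫ r in (0 : ℝ)..t, φ r) (Set.Icc 0 T) := by
    rw [← Set.uIcc_of_le hT]
    refine intervalIntegral.continuousOn_primitive_interval ?_
    rw [Set.uIcc_of_le hT]
    exact (intervalIntegrable_iff_integrableOn_Icc_of_le hT).1 hφ
  refine ⟨?_, fun t _ _ => intervalIntegral.integral_same,
    fun s t u h1 h2 h3 h4 => (hadd s t u h1 h2 h3 h4).le,
    fun s t _ hst _ => intervalIntegral.integral_nonneg hst fun r _ => h0 r⟩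
  have hc : ContinuousOn (fun pr : ℝ × ℝ => (∫ r in (0 : ℝ)..pr.2, φ r) - ∫ r in (0 : ℝ)..pr.1, φ r)
      {pr : ℝ × ℝ | 0 ≤ pr.1 ∧ pr.1 ≤ pr.2 ∧ pr.2 ≤ T} :=
    (hprim.comp continuousOn_snd fun pr hpr => ⟨hpr.1.trans hpr.2.1, hpr.2.2⟩).sub
      (hprim.comp continuousOn_fst fun pr hpr => ⟨hpr.1, hpr.2.1.trans hpr.2.2⟩)
  refine hc.congr fun pr hpr => ?_
  have := hadd 0 pr.1 pr.2 le_rfl hpr.1 hpr.2.1 hpr.2.2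
  simp only
  linarith

/-- A power integrability of exponent at least `1` implies integrability on bounded intervals. -/
lemma intervalIntegrable_abs_of_rpow {b : ℝ → ℝ} {u v c : ℝ} (hc : 1 ≤ c)
    (hb : IntervalIntegrable (fun s => |b s| ^ c) MeasureTheory.volume u v) :
    IntervalIntegrable (fun s => |b s|) MeasureTheory.volume u v := by
  have hc0 : 0 < c := by linarith
  have hroot : (fun s => |b s|) = fun s => (|b s| ^ c) ^ (1 / c) := by
    funext s
    rw [← Real.rpow_mul (abs_nonneg _), mul_one_div_cancel hc0.ne', Real.rpow_one]
  have hmeas : MeasureTheory.AEStronglyMeasurable (fun s => |b s|)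
      (MeasureTheory.volume.restrict (Set.uIoc u v)) := by
    rw [hroot]
    exact (Real.continuous_rpow_const (by positivity)).comp_aestronglyMeasurable
      (intervalIntegrable_iff.1 hb).aestronglyMeasurable
  refine ((intervalIntegrable_const (c := (1 : ℝ))).add hb).mono_fun hmeas
    (Filter.Eventually.of_forall fun s => ?_)
  have h0 : 0 ≤ |b s| ^ c := Real.rpow_nonneg (abs_nonneg _) _
  simp only
  rw [Real.norm_of_nonneg (abs_nonneg _), Real.norm_of_nonneg (by linarith)]
  rcases le_total |b s| 1 with h | h
  · linarith
  · have := Real.rpow_le_rpow_of_exponent_le h hc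
    rw [Real.rpow_one] at this
    linarith

section YoungSystem

variable {E F : Type*} [NormedAddCommGroup E] [NormedSpace ℝ E]
  [NormedAddCommGroup F] [NormedSpace ℝ F]

lemma IsYoungSystem.mono_control {T a L G₀ β ρ : ℝ} {W W' : ℝ → ℝ → ℝ} {f : ℝ → F → F}
    {g : ℝ → F → (E →L[ℝ] F)} {ω : ℝ → E} (hS : IsYoungSystem T a L G₀ β ρ W f g ω)
    (hβ : 0 ≤ β) (hρ : 0 ≤ ρ) (hW' : IsSmallControl T W')
    (hle : ∀ s t, 0 ≤ s → s ≤ t → t ≤ T → W s t ≤ W' s t) :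
    IsYoungSystem T a L G₀ β ρ W' f g ω :=
  { hS with
    control := hW'
    sub_le := fun s t h1 h2 h3 => (hS.sub_le s t h1 h2 h3).trans (hle s t h1 h2 h3)
    f_growth := fun ξ s t h1 h2 h3 => (hS.f_growth ξ s t h1 h2 h3).trans
      (mul_le_mul_of_nonneg_left (hle s t h1 h2 h3)
        (by have := hS.a_nonneg; positivity))
    g_time := fun s t x h1 h2 h3 => (hS.g_time s t x h1 h2 h3).trans
      (Real.rpow_le_rpow (hS.control.nonneg s t h1 h2 h3) (hle s t h1 h2 h3) hβ)
    ω_le := fun s t h1 h2 h3 => (hS.ω_le s t h1 h2 h3).trans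
      (Real.rpow_le_rpow (hS.control.nonneg s t h1 h2 h3) (hle s t h1 h2 h3) hρ) }

/-- A field of linear growth `a ‖ξ‖ + b r` is controlled by `t - s` and the integral of `|b|`. -/
lemma norm_integral_le_of_linear_growth {T a : ℝ} {f : ℝ → F → F} {b : ℝ → ℝ}
    (hf : ∀ t ∈ Set.Icc (0 : ℝ) T, ∀ x, ‖f t x‖ ≤ a * ‖x‖ + b t)
    (hT : 0 ≤ T) (ha : 0 ≤ a)
    (hb : IntervalIntegrable (fun s => |b s|) MeasureTheory.volume 0 T) (ξ : F) {s t : ℝ}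
    (hs : 0 ≤ s) (hst : s ≤ t) (ht : t ≤ T) :
    ‖∫ r in s..t, f r ξ‖ ≤ (a * ‖ξ‖ + 1) * (t - s + ∫ r in s..t, |b r|) := by
  have hb' : IntervalIntegrable (fun s => |b s|) MeasureTheory.volume s t :=
    hb.mono_set (by
      rw [Set.uIcc_of_le hst, Set.uIcc_of_le hT]
      exact Set.Icc_subset_Icc hs ht)
  have hI : 0 ≤ ∫ r in s..t, |b r| :=
    intervalIntegral.integral_nonneg hst fun r _ => abs_nonneg _
  have h1 : ‖∫ r in s..t, f r ξ‖ ≤ ∫ r in s..t, (a * ‖ξ‖ + |b r|) := by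
    refine intervalIntegral.norm_integral_le_of_norm_le hst
      (Filter.Eventually.of_forall fun r hr => ?_) (intervalIntegrable_const.add hb')
    exact (hf r ⟨hs.trans hr.1.le, hr.2.trans ht⟩ ξ).trans
      (add_le_add le_rfl (le_abs_self _))
  rw [intervalIntegral.integral_add intervalIntegrable_const hb',
    intervalIntegral.integral_const, smul_eq_mul] at h1
  have haξ : 0 ≤ a * ‖ξ‖ := by positivity
  nlinarith [mul_nonneg haξ hI]

end YoungSystem

/-- Theorem `theo3`, existence and uniqueness for the backward equation:
under (H1)–(H3), for any `xT ∈ ℝ^d` the backward Young differential equation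
`x t = xT + ∫_t^T f(s,x_s) ds + ∫_t^T g(s,x_s) dω_s`, `t ∈ [0,T]`, has a unique solution
of finite `q`-variation on `[0,T]`. -/
theorem stmt15
    {d m : ℕ} (p T : ℝ) (hp1 : 1 < p) (hp2 : p < 2) (hT : 0 < T)
    (f : ℝ → Ed d → Ed d) (g : ℝ → Ed d → (Ed m →L[ℝ] Ed d))
    (hf : ContinuousOn (fun pr : ℝ × Ed d => f pr.1 pr.2) (Set.Icc 0 T ×ˢ Set.univ))
    (hg : ContinuousOn (fun pr : ℝ × Ed d => g pr.1 pr.2) (Set.Icc 0 T ×ˢ Set.univ))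
    (Dg : ℝ → Ed d → (Ed d →L[ℝ] Ed m →L[ℝ] Ed d))
    (hDg : ∀ t ∈ Set.Icc (0:ℝ) T, ∀ x : Ed d, HasFDerivAt (g t) (Dg t x) x)
    (β δ Lg : ℝ) (hβ0 : 0 < β) (hβ1 : β ≤ 1) (hδ0 : 0 < δ) (hδ1 : δ ≤ 1) (hLg : 0 < Lg)
    (h : ℝ → ℝ → ℝ) (hctrl : IsControlOn 0 T h)
    (MN : ℝ → ℝ) (hMN : ∀ N : ℝ, 0 ≤ N → 0 < MN N)
    (H1i : ∀ t ∈ Set.Icc (0:ℝ) T, ∀ x y : Ed d, ‖g t x - g t y‖ ≤ Lg * ‖x - y‖)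
    (H1ii : ∀ N : ℝ, 0 ≤ N → ∀ t ∈ Set.Icc (0:ℝ) T, ∀ x y : Ed d, ‖x‖ ≤ N → ‖y‖ ≤ N →
      ‖Dg t x - Dg t y‖ ≤ MN N * ‖x - y‖ ^ δ)
    (H1iii : ∀ s t : ℝ, 0 ≤ s → s < t → t ≤ T → ∀ x : Ed d,
      ‖g t x - g s x‖ + ‖Dg t x - Dg s x‖ ≤ h s t ^ β)
    (a α : ℝ) (b : ℝ → ℝ) (ha : 0 < a) (hα1 : 1 / 2 ≤ α) (hα2 : α < 1)
    (hbmem : IntervalIntegrable (fun s => |b s| ^ (1 / (1 - α))) MeasureTheory.volume 0 T)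
    (LN : ℝ → ℝ) (hLN : ∀ N : ℝ, 0 ≤ N → 0 < LN N)
    (H2i : ∀ N : ℝ, 0 ≤ N → ∀ t ∈ Set.Icc (0:ℝ) T, ∀ x y : Ed d, ‖x‖ ≤ N → ‖y‖ ≤ N →
      ‖f t x - f t y‖ ≤ LN N * ‖x - y‖)
    (H2ii : ∀ t ∈ Set.Icc (0:ℝ) T, ∀ x : Ed d, ‖f t x‖ ≤ a * ‖x‖ + b t)
    (H3a : p - 1 < δ) (H3b : 1 - 1 / p < β) (H3c : 1 - 1 / p < δ * α)
    (q0 q : ℝ)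
    (hq0a : 1 - 1 / p < 1 / q0)
    (hq0b : 1 / q0 < min (min β (δ * α)) (min (δ / p) (1 / 2)))
    (hqa : 1 / (q0 * δ) ≤ 1 / q) (hqb : 1 / q < min α (1 / p))
    (ω : ℝ → Ed m) (hω : ContinuousOn ω (Set.Icc 0 T)) (hωp : FinitePVar p ω 0 T)
    (xT : Ed d) :
    ∃ x : ℝ → Ed d, IsBackwardSolutionOn f g ω q T xT x ∧
      ∀ y : ℝ → Ed d, IsBackwardSolutionOn f g ω q T xT y →
        ∀ t ∈ Set.Icc (0:ℝ) T, y t = x t := by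
  have hr1 : 1 / p < 1 := by rw [div_lt_one (by linarith)]; exact hp1
  have hq0 : 0 < q0 := one_div_pos.1 (by linarith)
  have hq : 0 < q := one_div_pos.1 (lt_of_lt_of_le (by positivity) hqa)
  have hκ : 0 < 1 / q := by positivity
  have hκr : 1 / q < 1 / p := hqb.trans_le (min_le_right _ _)
  have hδκ : 1 - 1 / p < 1 / q * δ := by
    refine hq0a.trans_le ?_
    calc 1 / q0 = 1 / (q0 * δ) * δ := by field_simp
      _ ≤ 1 / q * δ := mul_le_mul_of_nonneg_right hqa hδ0.le
  obtain ⟨ρ, hρ, hρr⟩ : ∃ ρ, max (1 / q) (max (1 - β) (1 - 1 / q * δ)) < ρ ∧ ρ < 1 / p :=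
    exists_between (max_lt hκr (max_lt (by linarith) (by linarith)))
  simp only [max_lt_iff] at hρ
  obtain ⟨hκρ, hβρ, hδρ⟩ := hρ
  have hρ0 : 0 < ρ := hκ.trans hκρ
  obtain ⟨γ, hργ, hγκ⟩ : ∃ γ, (1 - ρ) / δ < γ ∧ γ < 1 / q :=
    exists_between (by rw [div_lt_iff₀ hδ0]; linarith)
  have hγ0 : 0 < γ := lt_trans (div_pos (by linarith) hδ0) hργ
  have hpρ : p < 1 / ρ := (lt_one_div (by linarith) hρ0).2 hρr
  have hqγ : q < 1 / γ := (lt_one_div hq hγ0).2 hγκ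
  have hb : IntervalIntegrable (fun s => |b s|) MeasureTheory.volume 0 T :=
    intervalIntegrable_abs_of_rpow (by
      rw [le_div_iff₀ (by linarith)]
      linarith) hbmem
  obtain ⟨hWω, hωle⟩ := isSmallControl_sSup_pVarSums (by linarith) hpρ hω hωp
  rw [one_div_one_div] at hωle
  have hWh := hctrl.isSmallControl
  have hWsub := (isControlOn_sub T).isSmallControl
  have hWb := (isControlOn_integral hT.le (fun t => abs_nonneg (b t)) hb).isSmallControl
  set Wω : ℝ → ℝ → ℝ := fun s t => sSup (pVarSums (1 / ρ) ω s t)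
  set W : ℝ → ℝ → ℝ := fun s t => (Wω s t + h s t) + ((t - s) + ∫ r in s..t, |b r|) with hWdef
  have hW : IsSmallControl T W := (hWω.add hWh).add (hWsub.add hWb)
  have hhW : ∀ s t, 0 ≤ s → s ≤ t → t ≤ T → h s t ^ β ≤ W s t ^ β := fun s t hs hst ht => by
    refine Real.rpow_le_rpow (hWh.nonneg s t hs hst ht) ?_ hβ0.le
    have h1 := hWω.nonneg s t hs hst ht
    have h2 := hWsub.nonneg s t hs hst ht
    have h3 := hWb.nonneg s t hs hst ht
    simp only [hWdef]
    linarith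
  have htime : ∀ s t x, 0 ≤ s → s ≤ t → t ≤ T →
      ‖g t x - g s x‖ + ‖Dg t x - Dg s x‖ ≤ W s t ^ β := fun s t x hs hst ht => by
    rcases hst.eq_or_lt with rfl | hst'
    · rw [sub_self (g s x), sub_self (Dg s x), norm_zero, ContinuousLinearMap.opNorm_zero, add_zero]
      exact Real.rpow_nonneg (hW.nonneg s s hs le_rfl ht) β
    · exact (H1iii s t hs hst' ht x).trans (hhW s t hs hst ht)
  obtain ⟨G₀, hG₀⟩ := isCompact_Icc.exists_bound_of_continuousOn
    (hg.comp (f := fun t : ℝ => (t, (0 : Ed d))) (by fun_prop) fun t ht => ⟨ht, Set.mem_univ _⟩)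
  have hS : IsYoungSystem T a Lg (max 0 G₀) β ρ W f g ω :=
    { control := hW
      sub_le := fun s t hs hst ht => by
        have h1 := hWω.nonneg s t hs hst ht
        have h2 := hWh.nonneg s t hs hst ht
        have h3 := hWb.nonneg s t hs hst ht
        simp only [hWdef]
        linarith
      a_nonneg := ha.le
      L_nonneg := hLg.le
      G₀_nonneg := le_max_left _ _
      f_cont := hf
      f_lip := fun N hN => ⟨LN N, (hLN N hN).le, H2i N hN⟩
      f_growth := fun ξ s t hs hst ht => by
        refine (norm_integral_le_of_linear_growth H2ii hT.le ha.le hb ξ hs hst ht).trans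
          (mul_le_mul_of_nonneg_left ?_ (by positivity))
        have h1 := hWω.nonneg s t hs hst ht
        have h2 := hWh.nonneg s t hs hst ht
        simp only [hWdef]
        linarith
      g_cont := hg
      g_lip := H1i
      g_time := fun s t x hs hst ht =>
        le_of_add_le_of_nonneg_left (htime s t x hs hst ht) (norm_nonneg (Dg t x - Dg s x))
      g_zero := fun t ht => (hG₀ t ht).trans (le_max_right _ _)
      ω_cont := hω
      ω_le := fun s t hs hst ht => by
        refine (hωle s t hs hst ht).trans
          (Real.rpow_le_rpow (hWω.nonneg s t hs hst ht) ?_ hρ0.le)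
        have h1 := hWh.nonneg s t hs hst ht
        have h2 := hWsub.nonneg s t hs hst ht
        have h3 := hWb.nonneg s t hs hst ht
        simp only [hWdef]
        linarith }
  have hθ : 1 < min β (1 / q) + ρ := by
    have : 1 / q * δ ≤ 1 / q := mul_le_of_le_one_right hκ.le hδ1
    rcases min_choice β (1 / q) with h' | h' <;> rw [h'] <;> linarith
  obtain ⟨x, hxc, hxp, hxT, hx⟩ := hS.exists_solution (lt_min hβ0 hκ) (min_le_left _ _)
    (min_le_right _ _) hκρ (by linarith) hθ hT xT
  refine ⟨x, ⟨hxc, hxp, hxT, hx⟩, fun y ⟨hyc, hyp, hyT, hy⟩ => ?_⟩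
  obtain ⟨hWx, hxle⟩ := isSmallControl_sSup_pVarSums hq hqγ hxc hxp
  obtain ⟨hWy, hyle⟩ := isSmallControl_sSup_pVarSums hq hqγ hyc hyp
  rw [one_div_one_div] at hxle hyle
  set Wx : ℝ → ℝ → ℝ := fun s t => sSup (pVarSums (1 / γ) x s t)
  set Wy : ℝ → ℝ → ℝ := fun s t => sSup (pVarSums (1 / γ) y s t)
  set W' : ℝ → ℝ → ℝ := fun s t => W s t + (Wx s t + Wy s t) with hW'def
  have hle : ∀ s t, 0 ≤ s → s ≤ t → t ≤ T →
      W s t ≤ W' s t ∧ Wx s t ≤ W' s t ∧ Wy s t ≤ W' s t := fun s t hs hst ht => by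
    have h1 := hW.nonneg s t hs hst ht
    have h2 := hWx.nonneg s t hs hst ht
    have h3 := hWy.nonneg s t hs hst ht
    simp only [hW'def]
    exact ⟨by linarith, by linarith, by linarith⟩
  have hS' : IsYoungSystem T a Lg (max 0 G₀) β ρ W' f g ω :=
    hS.mono_control hβ0.le hρ0.le (hW.add (hWx.add hWy)) fun s t hs hst ht =>
      (hle s t hs hst ht).1
  have hθ' : 1 < min β (γ * δ) + ρ := by
    have : 1 - ρ < γ * δ := (div_lt_iff₀ hδ0).1 hργ
    rcases min_choice β (γ * δ) with h' | h' <;> rw [h'] <;> linarith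
  exact hS'.solution_unique hDg (fun N hN => ⟨MN N, (hMN N hN).le, H1ii N hN⟩)
    (fun s t z hs hst ht => (le_of_add_le_of_nonneg_right (htime s t z hs hst ht) (norm_nonneg _)).trans
      (Real.rpow_le_rpow (hW.nonneg s t hs hst ht) (hle s t hs hst ht).1 hβ0.le))
    hδ0 hδ1 (lt_min hβ0 (by positivity)) (min_le_left _ _) (min_le_right _ _)
    (hγκ.trans hκρ) (by linarith) hθ' hT.le hyc hxc
    (fun s t hs hst ht => (hyle s t hs hst ht).trans
      (Real.rpow_le_rpow (hWy.nonneg s t hs hst ht) (hle s t hs hst ht).2.2 hγ0.le))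
    (fun s t hs hst ht => (hxle s t hs hst ht).trans
      (Real.rpow_le_rpow (hWx.nonneg s t hs hst ht) (hle s t hs hst ht).2.1 hγ0.le))
    hyT hxT hy hx
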